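/- Fix k ∈ (0,1) and t = k/4. Then: (a) for all integers m,m' ≥ 1, Σ_{n=1}^∞ n·a_{n,m}·a_{n,m'} = (m·(q_k^{−m} − q_k^{m})/4) if m = m' and 0 otherwise, the sum converging absolutely; (b) for all integers l,m ≥ 1, Σ_{p=1}^∞ J_{l,p}(t)·a_{p,m} = a_{l,m} / (q_k^{m/2} + q_k^{−m/2}), where J_{l,p}(t) := W^{(π/2,(−π/2,π/2))}_{l,p}(t), the sum converging absolutely. -/

import Mathlib

open Complex Real Set

noncomputable section

/-- A lattice point `(x,y)` viewed as the complex number `x + iy`. -/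
def ptC (p : ℤ × ℤ) : ℂ := (p.1 : ℂ) + (p.2 : ℂ) * Complex.I

/-- A diagonal step on `ℤ²`. -/
def IsDiagStep (a b : ℤ × ℤ) : Prop :=
  b - a = (1, 1) ∨ b - a = (1, -1) ∨ b - a = (-1, -1) ∨ b - a = (-1, 1)

/-- A rectilinear step on `ℤ²`. -/
def IsRectStep (a b : ℤ × ℤ) : Prop :=
  b - a = (1, 0) ∨ b - a = (-1, 0) ∨ b - a = (0, 1) ∨ b - a = (0, -1)

/-- `w` encodes a simple diagonal walk `(w₀, …, w_n)` as a list of length `n+1`. -/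
def IsWalkList (w : List (ℤ × ℤ)) : Prop := w ≠ [] ∧ w.Chain' IsDiagStep

/-- Winding angle of the walk `w` around the origin up to time `i`. -/
def windTo (w : List (ℤ × ℤ)) (i : ℕ) : ℝ :=
  ∑ j ∈ Finset.range i, (ptC (w.getD (j + 1) 0) / ptC (w.getD j 0)).arg

/-- The full winding angle of the walk `w` around the origin. -/
def wind (w : List (ℤ × ℤ)) : ℝ := windTo w (w.length - 1)

/-- The condition on walks counted by `W^{(α,I)}_{l,p}`: a simple diagonal walk on
`ℤ² ∖ {0}` from `(p,0)` to a point on one of the axes at distance `l` from the origin,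
with full winding angle `α` and intermediate winding angles in `I`. -/
def WCond (l p : ℕ) (α : ℝ) (I : Set ℝ) (w : List (ℤ × ℤ)) : Prop :=
  IsWalkList w ∧ (∀ x ∈ w, x ≠ (0, 0)) ∧ w.head? = some ((p : ℤ), 0) ∧
    (w.getLast? = some ((l : ℤ), 0) ∨ w.getLast? = some (-(l : ℤ), 0) ∨
      w.getLast? = some (0, (l : ℤ)) ∨ w.getLast? = some (0, -(l : ℤ))) ∧
    wind w = α ∧ (∀ i, 1 ≤ i → i ≤ w.length - 2 → windTo w i ∈ I)

/-- The generating function `W^{(α,I)}_{l,p}(t)`. -/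
def Wgen (t : ℝ) (l p : ℕ) (α : ℝ) (I : Set ℝ) : ℝ :=
  ∑' w : {w : List (ℤ × ℤ) // WCond l p α I w}, t ^ (w.val.length - 1)

/-- The complete elliptic integral of the first kind `K(k)`. -/
def Kell (k : ℝ) : ℝ := ∫ y in (0:ℝ)..1, 1 / Real.sqrt ((1 - y ^ 2) * (1 - k ^ 2 * y ^ 2))

/-- The complete elliptic integral of the second kind `E(k)`. -/
def Eell (k : ℝ) : ℝ := ∫ y in (0:ℝ)..1, Real.sqrt (1 - k ^ 2 * y ^ 2) / Real.sqrt (1 - y ^ 2)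

/-- The complementary modulus `k' = √(1-k²)`. -/
def kComp (k : ℝ) : ℝ := Real.sqrt (1 - k ^ 2)

/-- The elliptic nome `q_k = exp(-π K(k')/K(k))`. -/
def qNome (k : ℝ) : ℝ := Real.exp (-π * Kell (kComp k) / Kell k)

/-- The descending Landen transformation `k₁ = (1-k')/(1+k')`. -/
def kLanden (k : ℝ) : ℝ := (1 - kComp k) / (1 + kComp k)

/-- `T_k = K(k')/(4K(k))`. -/
def Tell (k : ℝ) : ℝ := Kell (kComp k) / (4 * Kell k)

/-- The plane minus the two real slits `{z ∈ ℝ : z² ≥ κ}`. -/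
def slitDom (κ : ℝ) : Set ℂ := {z : ℂ | ¬(z.im = 0 ∧ κ ≤ z.re ^ 2)}

/-- `v` is the analytic function `v_κ` on `ℂ ∖ {z ∈ ℝ : z² ≥ κ}` with `v 0 = 0` and
`v'(z) = 1/(4K(κ)√((κ-z²)(1-κz²)))`, the branch of the square root being positive on
`(-√κ, √κ)` (by analytic continuation this determines `v` uniquely). -/
structure IsVmap (κ : ℝ) (v : ℂ → ℂ) : Prop where
  map_zero : v 0 = 0
  analytic : AnalyticOnNhd ℂ v (slitDom κ)
  deriv_real : ∀ x : ℝ, x ^ 2 < κ →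
    HasDerivAt v ((1 / (4 * Kell κ * Real.sqrt ((κ - x ^ 2) * (1 - κ * x ^ 2))) : ℝ) : ℂ)
      (x : ℂ)

/-- The function `f_m(z) = cos(2πm(v(z) + 1/4)) - cos(πm/2)` built from `v = v_{k₁}`. -/
def fmFun (v : ℂ → ℂ) (m : ℕ) (z : ℂ) : ℂ :=
  Complex.cos (2 * (π : ℂ) * m * (v z + 1 / 4)) - Complex.cos ((π : ℂ) * m / 2)

/-- `a n m` is the (real) Taylor coefficient `[zⁿ] f_m(z)` at `0`. -/
def IsCoeff (κ : ℝ) (v : ℂ → ℂ) (a : ℕ → ℕ → ℝ) : Prop :=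
  ∀ m : ℕ, 1 ≤ m → ∀ z : ℂ, z ∈ slitDom κ → ‖z‖ < 1 →
    HasSum (fun n : ℕ => (a n m : ℂ) * z ^ n) (fmFun v m z)

/-- An excursion: a nonempty simple diagonal walk from the origin to the origin with no
intermediate visits to the origin. -/
def IsExcursion (w : List (ℤ × ℤ)) : Prop :=
  2 ≤ w.length ∧ w.Chain' IsDiagStep ∧ w.head? = some (0, 0) ∧ w.getLast? = some (0, 0) ∧
    ∀ i, 1 ≤ i → i ≤ w.length - 2 → w.getD i 0 ≠ (0, 0)

/-- The winding angle sequence of an excursion: `θ₀ = θ₁ = 0`, increments of the first and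
last step do not contribute, and `θ_n = θ_{n-1}`. -/
def windExcTo (w : List (ℤ × ℤ)) (i : ℕ) : ℝ :=
  ∑ j ∈ Finset.Icc 2 (min i (w.length - 2)), (ptC (w.getD j 0) / ptC (w.getD (j - 1) 0)).arg

/-- The full winding angle of an excursion. -/
def windExc (w : List (ℤ × ℤ)) : ℝ := windExcTo w (w.length - 1)

/-- `F^{(α)}(t)`: generating function of excursions with winding angle `α`. -/
def Fgen (t α : ℝ) : ℝ :=
  ∑' w : {w : List (ℤ × ℤ) // IsExcursion w ∧ windExc w = α}, t ^ (w.val.length - 1)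

/-- `F(t,b) = Σ_w t^{|w|} e^{i b θ^w}`, the characteristic function of excursions. -/
def Fchar (t b : ℝ) : ℂ :=
  ∑' w : {w : List (ℤ × ℤ) // IsExcursion w},
    (t : ℂ) ^ (w.val.length - 1) * Complex.exp (Complex.I * b * windExc w.val)

/-- `ψ_k(z) = (1 - √(1-kz²))/(√k z)` (principal square root), `ψ_k(0) = 0`. -/
def psiK (k : ℝ) (z : ℂ) : ℂ :=
  if z = 0 then 0 else (1 - (1 - (k : ℂ) * z ^ 2) ^ ((1 : ℂ) / 2)) / ((Real.sqrt k : ℂ) * z)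

/-! ### Walks in the right half-plane -/

/-- The four diagonal neighbours of a lattice point. -/
def diagNbrs (a : ℤ × ℤ) : Finset (ℤ × ℤ) :=
  {a + (1, 1), a + (1, -1), a + (-1, -1), a + (-1, 1)}

lemma mem_diagNbrs {a b : ℤ × ℤ} : b ∈ diagNbrs a ↔ IsDiagStep a b := by
  simp only [diagNbrs, Finset.mem_insert, Finset.mem_singleton, IsDiagStep, sub_eq_iff_eq_add']

lemma sum_diagNbrs {M : Type*} [AddCommMonoid M] (a : ℤ × ℤ) (f : ℤ × ℤ → M) :
    ∑ b ∈ diagNbrs a, f b =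
      f (a + (1, 1)) + (f (a + (1, -1)) + (f (a + (-1, -1)) + f (a + (-1, 1)))) := by
  unfold diagNbrs
  rw [Finset.sum_insert, Finset.sum_insert, Finset.sum_insert, Finset.sum_singleton] <;>
    simp

/-- Walks of length `n` from `a` to `(0, l)` whose points other than the last lie in the open
right half-plane. -/
def halfWalks (l : ℤ) : ℕ → ℤ × ℤ → Finset (List (ℤ × ℤ))
  | 0, a => if a = (0, l) then {[a]} else ∅
  | n + 1, a =>
    if 0 < a.1 then (diagNbrs a).biUnion fun b => (halfWalks l n b).image (a :: ·) else ∅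

lemma mem_halfWalks {l : ℤ} {n : ℕ} {a : ℤ × ℤ} {w : List (ℤ × ℤ)} :
    w ∈ halfWalks l n a ↔ w.length = n + 1 ∧ w.head? = some a ∧ w.IsChain IsDiagStep ∧
      w.getLast? = some (0, l) ∧ ∀ x ∈ w.dropLast, 0 < x.1 := by
  induction n generalizing a w with
  | zero =>
    constructor
    · intro h
      simp only [halfWalks] at h
      split_ifs at h with ha
      · simp only [Finset.mem_singleton] at h
        subst h
        simp [ha]
      · simp at h
    · rintro ⟨h1, h2, -, h4, -⟩
      obtain ⟨b, rfl⟩ := List.length_eq_one_iff.1 h1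
      simp only [List.head?_cons, Option.some.injEq, List.getLast?_singleton] at h2 h4
      subst h2
      simp [halfWalks, h4]
  | succ n ih =>
    simp only [halfWalks]
    constructor
    · intro h
      split_ifs at h with ha
      · simp only [Finset.mem_biUnion, Finset.mem_image] at h
        obtain ⟨b, hb, w', hw', rfl⟩ := h
        obtain ⟨h1, h2, h3, h4, h5⟩ := ih.1 hw'
        obtain _ | ⟨c, w''⟩ := w'
        · simp at h1
        · simp only [List.head?_cons, Option.some.injEq] at h2
          subst h2
          refine ⟨by simpa using h1, by simp, ?_, by simpa using h4, ?_⟩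
          · exact List.isChain_cons_cons.2 ⟨mem_diagNbrs.1 hb, h3⟩
          · intro x hx
            rw [List.dropLast_cons_cons, List.mem_cons] at hx
            rcases hx with rfl | hx
            · exact ha
            · exact h5 x hx
      · simp at h
    · rintro ⟨h1, h2, h3, h4, h5⟩
      obtain _ | ⟨c, _ | ⟨b, w''⟩⟩ := w
      · simp at h1
      · simp at h1
      · simp only [List.head?_cons, Option.some.injEq] at h2
        subst h2
        rw [List.dropLast_cons_cons] at h5
        rw [if_pos (h5 c (by simp))]
        simp only [Finset.mem_biUnion, Finset.mem_image]
        rw [List.isChain_cons_cons] at h3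
        refine ⟨b, mem_diagNbrs.2 h3.1, b :: w'', ih.2 ⟨by simpa using h1, by simp, h3.2,
          by simpa using h4, fun x hx => h5 x (by simp [hx])⟩, rfl⟩

lemma card_halfWalks_succ (l : ℤ) (n : ℕ) (a : ℤ × ℤ) (ha : 0 < a.1) :
    (halfWalks l (n + 1) a).card = ∑ b ∈ diagNbrs a, (halfWalks l n b).card := by
  rw [halfWalks, if_pos ha, Finset.card_biUnion]
  · refine Finset.sum_congr rfl fun b _ => ?_
    exact Finset.card_image_of_injective _ (List.cons_injective)
  · intro b _ c _ hbc
    rw [Function.onFun, Finset.disjoint_left]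
    simp only [Finset.mem_image, not_exists, not_and]
    rintro _ ⟨w, hw, rfl⟩ w' hw' h
    have := (mem_halfWalks.1 hw).2.1
    have h2 := (mem_halfWalks.1 hw').2.1
    rw [(List.cons_injective h : w' = w)] at h2
    rw [h2] at this
    exact hbc (Option.some.inj this).symm

/-- Any bounded solution of the first-step equations is the generating function of
`halfWalks`. -/
lemma hasSum_card_halfWalks (l : ℤ) (t : ℝ) (ht0 : 0 ≤ t) (ht1 : 4 * t < 1)
    (I : ℤ × ℤ → ℝ) (hI : ∀ a, 0 ≤ a.1 → |I a| ≤ 1)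
    (h0 : ∀ y, I (0, y) = if y = l then 1 else 0)
    (hrec : ∀ a : ℤ × ℤ, 0 < a.1 → I a = t * ∑ b ∈ diagNbrs a, I b)
    (a : ℤ × ℤ) (ha : 0 ≤ a.1) :
    HasSum (fun n => t ^ n * ((halfWalks l n a).card : ℝ)) (I a) := by
  have key : ∀ N : ℕ, ∀ a : ℤ × ℤ, 0 ≤ a.1 →
      |I a - ∑ n ∈ Finset.range N, t ^ n * ((halfWalks l n a).card : ℝ)| ≤ (4 * t) ^ N := by
    intro N
    induction N with
    | zero => intro a ha; simpa using hI a ha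
    | succ N ih =>
      intro a ha
      rw [Finset.sum_range_succ']
      rcases ha.eq_or_lt with h | h
      · obtain ⟨x, y⟩ := a
        simp only at h
        subst h
        have h1 : ∀ n, halfWalks l (n + 1) ((0 : ℤ), y) = ∅ := fun n => by simp [halfWalks]
        have h2 : ((halfWalks l 0 ((0 : ℤ), y)).card : ℝ) = if y = l then 1 else 0 := by
          simp only [halfWalks]
          by_cases hy : y = l <;> simp [hy]
        simp only [h1, h2, h0]
        simp
        positivity
      · have hne : a ≠ (0, l) := by rintro rfl; simp at h
        have h2 : halfWalks l 0 a = ∅ := by simp [halfWalks, hne]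
        have h3 : I a - (∑ n ∈ Finset.range N, t ^ (n + 1) * ((halfWalks l (n + 1) a).card : ℝ)
              + t ^ 0 * ((halfWalks l 0 a).card : ℝ))
            = t * ∑ b ∈ diagNbrs a,
              (I b - ∑ n ∈ Finset.range N, t ^ n * ((halfWalks l n b).card : ℝ)) := by
          rw [hrec a h, h2, Finset.sum_sub_distrib, mul_sub, Finset.sum_comm]
          simp only [Finset.card_empty, Nat.cast_zero, mul_zero, add_zero]
          congr 1
          rw [Finset.mul_sum]
          refine Finset.sum_congr rfl fun n _ => ?_
          rw [card_halfWalks_succ l n a h]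
          push_cast
          rw [← Finset.mul_sum, pow_succ]
          ring
        rw [h3, abs_mul, abs_of_nonneg ht0]
        have h4 : |∑ b ∈ diagNbrs a,
              (I b - ∑ n ∈ Finset.range N, t ^ n * ((halfWalks l n b).card : ℝ))|
            ≤ ∑ b ∈ diagNbrs a, (4 * t) ^ N := by
          refine (Finset.abs_sum_le_sum_abs _ _).trans (Finset.sum_le_sum fun b hb => ih b ?_)
          rw [mem_diagNbrs] at hb
          have : b.1 - a.1 = 1 ∨ b.1 - a.1 = -1 := by
            rcases hb with h | h | h | h <;> simp [← Prod.fst_sub, h]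
          omega
        rw [sum_diagNbrs a fun _ => (4 * t) ^ N] at h4
        calc t * _ ≤ t * _ := mul_le_mul_of_nonneg_left h4 ht0
          _ = (4 * t) ^ (N + 1) := by ring
  rw [hasSum_iff_tendsto_nat_of_nonneg (fun n => by positivity)]
  rw [tendsto_iff_dist_tendsto_zero]
  refine squeeze_zero (fun _ => dist_nonneg) (fun N => ?_)
    (tendsto_pow_atTop_nhds_zero_of_lt_one (by positivity) ht1)
  rw [dist_comm, Real.dist_eq]
  exact key N a ha

lemma ptC_re (a : ℤ × ℤ) : (ptC a).re = a.1 := by simp [ptC]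

lemma ptC_im (a : ℤ × ℤ) : (ptC a).im = a.2 := by simp [ptC]

lemma ptC_ne_zero {a : ℤ × ℤ} (h : a ≠ (0, 0)) : ptC a ≠ 0 := by
  intro h0
  apply h
  have h1 := ptC_re a
  have h2 := ptC_im a
  rw [h0] at h1 h2
  simp only [Complex.zero_re, Complex.zero_im] at h1 h2
  ext
  · exact_mod_cast h1.symm
  · exact_mod_cast h2.symm

lemma sum_arg_div_coe_angle (z : ℕ → ℂ) (n : ℕ) (hz : ∀ i ≤ n, z i ≠ 0) (h0 : (z 0).arg = 0) :
    ((∑ j ∈ Finset.range n, (z (j + 1) / z j).arg : ℝ) : Real.Angle) = (z n).arg := by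
  induction n with
  | zero => simp [h0]
  | succ n ih =>
    rw [Finset.sum_range_succ, Real.Angle.coe_add, ih fun i hi => hz i (by omega),
      Complex.arg_div_coe_angle (hz _ le_rfl) (hz _ (by omega))]
    abel

lemma arg_eq_of_coe_angle_eq {z : ℂ} {θ : ℝ} (h : (θ : Real.Angle) = z.arg) (h1 : -π < θ)
    (h2 : θ ≤ π) : z.arg = θ := by
  rw [← Complex.arg_coe_angle_toReal_eq_arg z, ← h]
  exact Real.Angle.toReal_coe_eq_self_iff.2 ⟨h1, h2⟩

lemma sum_arg_div_of_re_pos (z : ℕ → ℂ) (n : ℕ) (hz : ∀ i < n, 0 < (z i).re)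
    (hn : (z n).re = 0) (hn' : z n ≠ 0) (h0 : (z 0).arg = 0) (i : ℕ) (hi : i ≤ n) :
    ∑ j ∈ Finset.range i, (z (j + 1) / z j).arg = (z i).arg := by
  have hne : ∀ i ≤ n, z i ≠ 0 := by
    intro i hi
    rcases hi.eq_or_lt with rfl | h
    · exact hn'
    · intro h1
      have := hz i h
      simp [h1] at this
  have hre : ∀ i ≤ n, 0 ≤ (z i).re := by
    intro i hi
    rcases hi.eq_or_lt with rfl | h
    · exact hn.ge
    · exact (hz i h).le
  induction i with
  | zero => simp [h0]
  | succ i ih =>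
    rw [Finset.sum_range_succ, ih (by omega)]
    have h1 := abs_lt.1 (Complex.abs_arg_lt_pi_div_two_iff.2 (Or.inl (hz i (by omega))))
    have h2 := abs_le.1 (Complex.abs_arg_le_pi_div_two_iff.2 (hre (i + 1) hi))
    have h3 := Complex.arg_div_coe_angle (hne (i + 1) hi) (hne i (by omega))
    rw [← Real.Angle.coe_sub] at h3
    have h4 := arg_eq_of_coe_angle_eq h3.symm (by linarith) (by linarith)
    rw [h4]
    ring

lemma getD_mem {w : List (ℤ × ℤ)} {i : ℕ} (hi : i < w.length) : w.getD i 0 ∈ w := by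
  rw [List.getD_eq_getElem _ _ hi]
  exact List.getElem_mem hi

lemma wCond_iff_mem_halfWalks {l p : ℕ} (hl : 1 ≤ l) (w : List (ℤ × ℤ)) :
    WCond l p (π / 2) (Set.Ioo (-(π / 2)) (π / 2)) w ↔
      w ∈ halfWalks l (w.length - 1) ((p : ℤ), 0) := by
  have hpi := Real.pi_pos
  have hp0 : (ptC ((p : ℤ), 0)).arg = 0 := by
    rw [Complex.arg_eq_zero_iff, ptC_re, ptC_im]
    simp
  have hhead : w.head? = some ((p : ℤ), 0) → w.getD 0 0 = ((p : ℤ), 0) := by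
    intro h
    cases w <;> simp_all
  have hlast : ∀ b, w.getLast? = some b → w.getD (w.length - 1) 0 = b := by
    intro b h
    rw [List.getLast?_eq_getElem?] at h
    rw [List.getD_eq_getElem?_getD, h]
    rfl
  rw [mem_halfWalks]
  constructor
  · rintro ⟨⟨hw, hc⟩, hnz, hh, hlst, hwd, hI⟩
    have hlen : 0 < w.length := List.length_pos_iff.2 hw
    set n := w.length - 1 with hn
    set z : ℕ → ℂ := fun i => ptC (w.getD i 0) with hz
    have hz0 : (z 0).arg = 0 := by simp only [hz, hhead hh, hp0]
    have hzne : ∀ i ≤ n, z i ≠ 0 := fun i hi => ptC_ne_zero (hnz _ (getD_mem (by omega)))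
    have hcoe : ∀ i ≤ n, ((windTo w i : ℝ) : Real.Angle) = (z i).arg := fun i hi =>
      sum_arg_div_coe_angle z i (fun j hj => hzne j (by omega)) hz0
    have hargn : (z n).arg = π / 2 := by
      refine arg_eq_of_coe_angle_eq ?_ (by linarith) (by linarith)
      rw [← hcoe n le_rfl, ← hwd]
      rfl
    have hre : ∀ i < n, 0 < (z i).re := by
      intro i hi
      have hmem : windTo w i ∈ Set.Ioo (-(π / 2)) (π / 2) := by
        rcases Nat.eq_zero_or_pos i with rfl | h
        · simp only [windTo, Finset.range_zero, Finset.sum_empty]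
          constructor <;> linarith
        · exact hI i h (by omega)
      have h1 := arg_eq_of_coe_angle_eq (hcoe i hi.le) (by linarith [hmem.1])
        (by linarith [hmem.2])
      have h2 : |(z i).arg| < π / 2 := by rw [h1]; exact abs_lt.2 hmem
      rcases Complex.abs_arg_lt_pi_div_two_iff.1 h2 with h | h
      · exact h
      · exact absurd h (hzne i hi.le)
    have hzn := Complex.arg_eq_pi_div_two_iff.1 hargn
    simp only [hz, ptC_re, ptC_im] at hzn
    refine ⟨by omega, hh, hc, ?_, ?_⟩
    · have hl' : (0 : ℤ) < l := by exact_mod_cast hl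
      rcases hlst with h | h | h | h
      · rw [hlast _ h] at hzn; simp at hzn
      · rw [hlast _ h] at hzn; simp at hzn
      · exact h
      · rw [hlast _ h] at hzn
        have := hzn.2
        simp only [Int.cast_neg, Int.cast_natCast] at this
        have h3 : (0 : ℝ) ≤ l := by positivity
        linarith
    · intro x hx
      obtain ⟨i, hi, rfl⟩ := List.getElem_of_mem hx
      have hi' : i < n := by simpa using hi
      have := hre i hi'
      simp only [hz, ptC_re] at this
      rw [List.getD_eq_getElem _ _ (by omega)] at this
      rw [List.getElem_dropLast]
      exact_mod_cast this
  · rintro ⟨h1, hh, hc, hlst, hdrop⟩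
    set n := w.length - 1 with hn
    set z : ℕ → ℂ := fun i => ptC (w.getD i 0) with hz
    have hlpos : (0 : ℝ) < l := by exact_mod_cast hl
    have hz0 : (z 0).arg = 0 := by simp only [hz, hhead hh, hp0]
    have hrepos : ∀ i < n, 0 < (w.getD i 0).1 := by
      intro i hi
      have hi' : i < w.dropLast.length := by simpa using hi
      rw [List.getD_eq_getElem _ _ (by omega), ← List.getElem_dropLast hi']
      exact hdrop _ (List.getElem_mem hi')
    have hre : ∀ i < n, 0 < (z i).re := by
      intro i hi
      simp only [hz, ptC_re]
      exact_mod_cast hrepos i hi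
    have hznre : (z n).re = 0 := by simp only [hz, ptC_re, hlast _ hlst]; simp
    have hznim : (z n).im = l := by simp only [hz, ptC_im, hlast _ hlst]; simp
    have hzn : z n ≠ 0 := by
      intro h
      rw [h, Complex.zero_im] at hznim
      exact hlpos.ne hznim
    have hwind := sum_arg_div_of_re_pos z n hre hznre hzn hz0
    refine ⟨⟨by rintro rfl; simp at hh, hc⟩, ?_, hh, Or.inr (Or.inr (Or.inl hlst)), ?_, ?_⟩
    · intro x hx
      obtain ⟨i, hi, rfl⟩ := List.getElem_of_mem hx
      intro h0
      rw [← List.getD_eq_getElem _ 0 hi] at h0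
      rcases (show i ≤ n by omega).eq_or_lt with h | h
      · rw [h, hlast _ hlst] at h0
        simp at h0
        omega
      · have := hrepos i h
        rw [h0] at this
        simp at this
    · have : wind w = (z n).arg := hwind n le_rfl
      rw [this, Complex.arg_eq_pi_div_two_iff]
      exact ⟨hznre, by rw [hznim]; exact hlpos⟩
    · intro i hi1 hi2
      have : windTo w i = (z i).arg := hwind i (by omega)
      rw [this]
      exact abs_lt.1 (Complex.abs_arg_lt_pi_div_two_iff.2 (Or.inl (hre i (by omega))))

lemma wgen_eq_of_hasSum {l p : ℕ} (hl : 1 ≤ l) {t S : ℝ} (ht : 0 ≤ t)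
    (h : HasSum (fun n => t ^ n * ((halfWalks l n ((p : ℤ), 0)).card : ℝ)) S) :
    Wgen t l p (π / 2) (Set.Ioo (-(π / 2)) (π / 2)) = S := by
  let e : (Σ n : ℕ, {w // w ∈ halfWalks l n ((p : ℤ), 0)}) ≃
      {w : List (ℤ × ℤ) // WCond l p (π / 2) (Set.Ioo (-(π / 2)) (π / 2)) w} :=
    { toFun := fun x => ⟨x.2.1, by
        have h1 := x.2.2
        have h2 := (mem_halfWalks.1 h1).1
        rw [wCond_iff_mem_halfWalks hl, h2]
        exact h1⟩
      invFun := fun w => ⟨w.1.length - 1, w.1, (wCond_iff_mem_halfWalks hl _).1 w.2⟩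
      left_inv := by
        rintro ⟨n, w, hw⟩
        have h2 := (mem_halfWalks.1 hw).1
        have h3 : w.length - 1 = n := by omega
        subst h3
        rfl
      right_inv := fun w => rfl }
  have hsum : HasSum (fun x : (Σ n : ℕ, {w // w ∈ halfWalks l n ((p : ℤ), 0)}) => t ^ x.1) S := by
    have hfib : ∀ n : ℕ, HasSum (fun w : {w // w ∈ halfWalks l n ((p : ℤ), 0)} => t ^ n)
        (t ^ n * ((halfWalks l n ((p : ℤ), 0)).card : ℝ)) := by
      intro n
      convert hasSum_fintype (fun w : {w // w ∈ halfWalks l n ((p : ℤ), 0)} => t ^ n) using 1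
      simp [mul_comm]
    have hsm : Summable
        (fun x : (Σ n : ℕ, {w // w ∈ halfWalks l n ((p : ℤ), 0)}) => t ^ x.1) := by
      rw [summable_sigma_of_nonneg (fun x => by positivity)]
      refine ⟨fun n => (hfib n).summable, ?_⟩
      simp only [fun n => (hfib n).tsum_eq]
      exact h.summable
    have := hsm.hasSum.sigma hfib
    have h5 := hsm.hasSum
    rwa [this.unique h] at h5
  rw [Wgen, ← e.tsum_eq]
  rw [← hsum.tsum_eq]
  refine tsum_congr fun x => ?_
  have h2 := (mem_halfWalks.1 x.2.2).1
  change t ^ (x.2.1.length - 1) = t ^ x.1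
  rw [h2]
  rfl

/-! ### The kernel of `J` as an integral -/

/-- The quantity `√(1 - k² cos² θ)`. -/
def ellRoot (k θ : ℝ) : ℝ := Real.sqrt (1 - (k * Real.cos θ) ^ 2)

/-- The solution `s ∈ [-1, 1]` of `s = (k / 2) cos θ (1 + s²)`. -/
def smallRoot (k θ : ℝ) : ℝ := k * Real.cos θ / (1 + ellRoot k θ)

lemma sq_mul_cos_lt_one {k : ℝ} (hk : k ∈ Set.Ioo (0 : ℝ) 1) (θ : ℝ) :
    (k * Real.cos θ) ^ 2 < 1 := by
  have h1 := Real.cos_sq_le_one θ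
  have h2 : k ^ 2 < 1 := by nlinarith [hk.1, hk.2]
  rw [mul_pow]
  nlinarith [sq_nonneg (Real.cos θ), sq_nonneg k]

lemma ellRoot_pos {k : ℝ} (hk : k ∈ Set.Ioo (0 : ℝ) 1) (θ : ℝ) : 0 < ellRoot k θ :=
  Real.sqrt_pos.2 (by linarith [sq_mul_cos_lt_one hk θ])

lemma ellRoot_sq {k : ℝ} (hk : k ∈ Set.Ioo (0 : ℝ) 1) (θ : ℝ) :
    ellRoot k θ ^ 2 = 1 - (k * Real.cos θ) ^ 2 :=
  Real.sq_sqrt (by linarith [sq_mul_cos_lt_one hk θ])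

lemma continuous_ellRoot (k : ℝ) : Continuous (ellRoot k) := by
  unfold ellRoot
  fun_prop

lemma continuous_smallRoot {k : ℝ} (hk : k ∈ Set.Ioo (0 : ℝ) 1) : Continuous (smallRoot k) := by
  unfold smallRoot
  have := continuous_ellRoot k
  exact Continuous.div (by fun_prop) (by fun_prop) fun θ => by linarith [ellRoot_pos hk θ]

lemma one_add_smallRoot_sq {k : ℝ} (hk : k ∈ Set.Ioo (0 : ℝ) 1) (θ : ℝ) :
    1 + smallRoot k θ ^ 2 = 2 / (1 + ellRoot k θ) := by
  have h := ellRoot_pos hk θ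
  have h2 := ellRoot_sq hk θ
  unfold smallRoot
  have : 1 + ellRoot k θ ≠ 0 := by positivity
  field_simp
  nlinarith

lemma smallRoot_eq {k : ℝ} (hk : k ∈ Set.Ioo (0 : ℝ) 1) (θ : ℝ) :
    k / 2 * Real.cos θ * (1 + smallRoot k θ ^ 2) = smallRoot k θ := by
  rw [one_add_smallRoot_sq hk, smallRoot]
  ring

lemma abs_smallRoot_le_one {k : ℝ} (hk : k ∈ Set.Ioo (0 : ℝ) 1) (θ : ℝ) :
    |smallRoot k θ| ≤ 1 := by
  have h := ellRoot_pos hk θ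
  have h1 := one_add_smallRoot_sq hk θ
  have h2 : 2 / (1 + ellRoot k θ) ≤ 2 := by
    rw [div_le_iff₀ (by positivity)]
    linarith
  rw [← sq_le_one_iff_abs_le_one]
  linarith

lemma integral_cos_int_mul (d : ℤ) :
    ∫ θ in (0 : ℝ)..π, Real.cos (d * θ) = if d = 0 then π else 0 := by
  split_ifs with h
  · simp [h]
  · have hd : (d : ℝ) ≠ 0 := by exact_mod_cast h
    rw [intervalIntegral.integral_comp_mul_left (fun x => Real.cos x) hd]
    simp [integral_cos, Real.sin_int_mul_pi]

lemma wgen_eq_integral {k : ℝ} (hk : k ∈ Set.Ioo (0 : ℝ) 1) {l : ℕ} (hl : 1 ≤ l) (p : ℕ) :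
    Wgen (k / 4) l p (π / 2) (Set.Ioo (-(π / 2)) (π / 2)) =
      π⁻¹ * ∫ θ in (0 : ℝ)..π, smallRoot k θ ^ p * Real.cos (l * θ) := by
  have hpi := Real.pi_pos
  have hcs := continuous_smallRoot hk
  apply wgen_eq_of_hasSum hl (by linarith [hk.1])
  set I : ℤ × ℤ → ℝ := fun a => π⁻¹ * ∫ θ in (0 : ℝ)..π,
    smallRoot k θ ^ a.1.toNat * Real.cos (((l - a.2 : ℤ) : ℝ) * θ) with hI
  have hint : ∀ a : ℤ × ℤ, IntervalIntegrable (fun θ =>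
      smallRoot k θ ^ a.1.toNat * Real.cos (((l - a.2 : ℤ) : ℝ) * θ)) MeasureTheory.volume 0 π :=
    fun a => Continuous.intervalIntegrable (by fun_prop) _ _
  have := hasSum_card_halfWalks l (k / 4) (by linarith [hk.1]) (by linarith [hk.2]) I ?_ ?_ ?_
    ((p : ℤ), 0) (by simp)
  · simpa [hI] using this
  · intro a _
    have h1 : ‖∫ θ in (0 : ℝ)..π,
        smallRoot k θ ^ a.1.toNat * Real.cos (((l - a.2 : ℤ) : ℝ) * θ)‖ ≤ 1 * |π - 0| := by
      apply intervalIntegral.norm_integral_le_of_norm_le_const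
      intro θ _
      rw [norm_mul, norm_pow, Real.norm_eq_abs, Real.norm_eq_abs]
      exact mul_le_one₀ (pow_le_one₀ (abs_nonneg _) (abs_smallRoot_le_one hk θ)) (abs_nonneg _)
        (Real.abs_cos_le_one _)
    simp only [hI]
    rw [abs_mul, abs_of_pos (inv_pos.2 hpi), inv_mul_le_iff₀ hpi]
    simpa [abs_of_pos hpi] using h1
  · intro y
    simp only [hI, Int.toNat_zero, pow_zero, one_mul]
    rw [integral_cos_int_mul]
    by_cases hy : y = l
    · simp [hy, hpi.ne']
    · rw [if_neg hy, if_neg (by omega), mul_zero]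
  · intro a ha
    rw [sum_diagNbrs]
    simp only [hI]
    rw [← mul_add, ← mul_add, ← mul_add, ← intervalIntegral.integral_add (hint _) (hint _),
      ← intervalIntegral.integral_add (hint _) ((hint _).add (hint _)),
      ← intervalIntegral.integral_add (hint _) ((hint _).add ((hint _).add (hint _))),
      mul_left_comm (k / 4)]
    congr 1
    rw [← intervalIntegral.integral_const_mul]
    apply intervalIntegral.integral_congr
    intro θ _
    obtain ⟨n, hn⟩ : ∃ n : ℕ, a.1 = n + 1 := ⟨(a.1 - 1).toNat, by omega⟩
    simp only [Prod.fst_add, Prod.snd_add, hn]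
    have e1 : ((n : ℤ) + 1).toNat = n + 1 := by omega
    have e2 : ((n : ℤ) + 1 + 1).toNat = n + 2 := by omega
    have e3 : ((n : ℤ) + 1 + -1).toNat = n := by omega
    rw [e1, e2, e3]
    set s := smallRoot k θ with hs
    have c1 : Real.cos (((l - (a.2 + 1) : ℤ) : ℝ) * θ) + Real.cos (((l - (a.2 + -1) : ℤ) : ℝ) * θ)
        = 2 * Real.cos θ * Real.cos (((l - a.2 : ℤ) : ℝ) * θ) := by
      have f1 : ((l - (a.2 + 1) : ℤ) : ℝ) * θ = ((l - a.2 : ℤ) : ℝ) * θ - θ := by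
        push_cast; ring
      have f2 : ((l - (a.2 + -1) : ℤ) : ℝ) * θ = ((l - a.2 : ℤ) : ℝ) * θ + θ := by
        push_cast; ring
      rw [f1, f2, Real.cos_sub, Real.cos_add]
      ring
    have h := smallRoot_eq hk θ
    rw [← hs] at h
    linear_combination (-(k / 4) * (s ^ (n + 2) + s ^ n)) * c1 -
      s ^ n * Real.cos (((l - a.2 : ℤ) : ℝ) * θ) * h

/-! ### Complete elliptic integrals and the amplitude -/

lemma integral_Ioo_comp_of_deriv_neg {f f' : ℝ → ℝ} {a b c d : ℝ} (hab : a < b)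
    (hf : ContinuousOn f (Set.Icc a b)) (hd : ∀ x ∈ Set.Ioo a b, HasDerivAt f (f' x) x)
    (hneg : ∀ x ∈ Set.Ioo a b, f' x < 0) (ha : f a = d) (hb : f b = c) (g : ℝ → ℝ) :
    ∫ y in Set.Ioo c d, g y = ∫ x in Set.Ioo a b, -f' x * g (f x) := by
  have hanti : StrictAntiOn f (Set.Icc a b) := by
    apply strictAntiOn_of_deriv_neg (convex_Icc a b) hf
    intro x hx
    rw [interior_Icc] at hx
    rw [(hd x hx).deriv]
    exact hneg x hx
  have himg : f '' Set.Ioo a b = Set.Ioo c d := by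
    apply Set.Subset.antisymm
    · rintro _ ⟨x, hx, rfl⟩
      rw [← ha, ← hb]
      exact ⟨hanti ⟨hx.1.le, hx.2.le⟩ (Set.right_mem_Icc.2 hab.le) hx.2,
        hanti (Set.left_mem_Icc.2 hab.le) ⟨hx.1.le, hx.2.le⟩ hx.1⟩
    · rw [← ha, ← hb]
      exact intermediate_value_Ioo' hab.le hf
  rw [← himg, MeasureTheory.integral_image_eq_integral_abs_deriv_smul measurableSet_Ioo
    (fun x hx => (hd x hx).hasDerivWithinAt) (hanti.injOn.mono Set.Ioo_subset_Icc_self)]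
  refine MeasureTheory.setIntegral_congr_fun measurableSet_Ioo fun x hx => ?_
  simp only [smul_eq_mul]
  rw [abs_of_neg (hneg x hx)]

lemma kComp_mem {k : ℝ} (hk : k ∈ Set.Ioo (0 : ℝ) 1) : kComp k ∈ Set.Ioo (0 : ℝ) 1 := by
  have h1 : k ^ 2 < 1 := by nlinarith [hk.1, hk.2]
  have h2 : 0 < k ^ 2 := by nlinarith [hk.1]
  refine ⟨Real.sqrt_pos.2 (by linarith), ?_⟩
  rw [kComp, Real.sqrt_lt' one_pos]
  linarith

lemma kComp_sq {k : ℝ} (hk : k ∈ Set.Ioo (0 : ℝ) 1) : kComp k ^ 2 = 1 - k ^ 2 :=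
  Real.sq_sqrt (by nlinarith [hk.1, hk.2])

lemma kLanden_mem {k : ℝ} (hk : k ∈ Set.Ioo (0 : ℝ) 1) : kLanden k ∈ Set.Ioo (0 : ℝ) 1 := by
  obtain ⟨h1, h2⟩ := kComp_mem hk
  rw [kLanden]
  refine ⟨div_pos (by linarith) (by linarith), ?_⟩
  rw [div_lt_one (by linarith)]
  linarith

lemma one_add_kLanden {k : ℝ} (hk : k ∈ Set.Ioo (0 : ℝ) 1) :
    1 + kLanden k = 2 / (1 + kComp k) := by
  obtain ⟨h1, h2⟩ := kComp_mem hk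
  have : 1 + kComp k ≠ 0 := by linarith
  rw [kLanden]
  field_simp
  ring

lemma four_mul_kLanden {k : ℝ} (hk : k ∈ Set.Ioo (0 : ℝ) 1) :
    4 * kLanden k = k ^ 2 * (1 + kLanden k) ^ 2 := by
  obtain ⟨h1, h2⟩ := kComp_mem hk
  have : 1 + kComp k ≠ 0 := by linarith
  rw [one_add_kLanden hk, kLanden]
  field_simp
  linear_combination (-4) * kComp_sq hk

lemma sqrt_kLanden {k : ℝ} (hk : k ∈ Set.Ioo (0 : ℝ) 1) :
    Real.sqrt (kLanden k) = k * (1 + kLanden k) / 2 := by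
  rw [Real.sqrt_eq_iff_mul_self_eq (kLanden_mem hk).1.le
    (by nlinarith [hk.1, (kLanden_mem hk).1])]
  linear_combination (1 / 4) * four_mul_kLanden hk

lemma hasDerivAt_ellRoot {k : ℝ} (hk : k ∈ Set.Ioo (0 : ℝ) 1) (θ : ℝ) :
    HasDerivAt (ellRoot k) (k ^ 2 * Real.cos θ * Real.sin θ / ellRoot k θ) θ := by
  have h0 : (1 - (k * Real.cos θ) ^ 2) ≠ 0 := by linarith [sq_mul_cos_lt_one hk θ]
  have h : HasDerivAt (ellRoot k) _ θ :=
    ((((Real.hasDerivAt_cos θ).const_mul k).pow 2).const_sub 1).sqrt h0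
  refine h.congr_deriv (Eq.symm ?_)
  have := ellRoot_pos hk θ
  change _ = _ / (2 * ellRoot k θ)
  field_simp
  push_cast
  ring

lemma hasDerivAt_smallRoot {k : ℝ} (hk : k ∈ Set.Ioo (0 : ℝ) 1) (θ : ℝ) :
    HasDerivAt (smallRoot k)
      (-(k * Real.sin θ / (ellRoot k θ * (1 + ellRoot k θ)))) θ := by
  have hR := ellRoot_pos hk θ
  have h : HasDerivAt (smallRoot k) _ θ := ((Real.hasDerivAt_cos θ).const_mul k).div ((hasDerivAt_ellRoot hk θ).const_add 1)
    (by positivity)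
  refine h.congr_deriv (Eq.symm ?_)
  have := ellRoot_sq hk θ
  field_simp
  linear_combination (k * Real.sin θ) * this

lemma smallRoot_poly {k : ℝ} (hk : k ∈ Set.Ioo (0 : ℝ) 1) (θ : ℝ) :
    (kLanden k - smallRoot k θ ^ 2) * (1 - kLanden k * smallRoot k θ ^ 2) =
      kLanden k * (2 * Real.sin θ / (1 + ellRoot k θ)) ^ 2 := by
  have h1 := one_add_smallRoot_sq hk θ
  have h2 := smallRoot_eq hk θ
  have h3 := four_mul_kLanden hk
  have h4 : (2 * Real.sin θ / (1 + ellRoot k θ)) ^ 2 =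
      (Real.sin θ * (1 + smallRoot k θ ^ 2)) ^ 2 := by rw [h1]; ring
  rw [h4]
  set s := smallRoot k θ
  set κ := kLanden k
  have h5 := Real.sin_sq_add_cos_sq θ
  linear_combination (-κ * (1 + s ^ 2) ^ 2) * h5 + (1 + κ) ^ 2 * (k / 2 * Real.cos θ * (1 + s ^ 2) + s) * h2
    + (Real.cos θ) ^ 2 * (1 + s ^ 2) ^ 2 / 4 * h3

lemma sqrt_smallRoot_poly {k : ℝ} (hk : k ∈ Set.Ioo (0 : ℝ) 1) {θ : ℝ} (hθ : 0 ≤ Real.sin θ) :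
    Real.sqrt ((kLanden k - smallRoot k θ ^ 2) * (1 - kLanden k * smallRoot k θ ^ 2)) =
      k * (1 + kLanden k) * Real.sin θ / (1 + ellRoot k θ) := by
  have hR := ellRoot_pos hk θ
  rw [smallRoot_poly hk, Real.sqrt_mul (kLanden_mem hk).1.le, Real.sqrt_sq (by positivity),
    sqrt_kLanden hk]
  ring

lemma smallRoot_sq_lt {k : ℝ} (hk : k ∈ Set.Ioo (0 : ℝ) 1) {θ : ℝ} (hθ : 0 < Real.sin θ) :
    smallRoot k θ ^ 2 < kLanden k := by
  have hκ := kLanden_mem hk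
  have hR := ellRoot_pos hk θ
  have h := smallRoot_poly hk θ
  have h1 : 0 < kLanden k * (2 * Real.sin θ / (1 + ellRoot k θ)) ^ 2 :=
    mul_pos hκ.1 (by positivity)
  have h2 := (sq_le_one_iff_abs_le_one _).2 (abs_smallRoot_le_one hk θ)
  have h3 : 0 < 1 - kLanden k * smallRoot k θ ^ 2 := by nlinarith [hκ.1, hκ.2]
  by_contra hcon
  push Not at hcon
  nlinarith

lemma kell_eq_setIntegral (k : ℝ) :
    Kell k = ∫ y in Set.Ioo (0 : ℝ) 1, 1 / Real.sqrt ((1 - y ^ 2) * (1 - k ^ 2 * y ^ 2)) := by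
  rw [Kell, intervalIntegral.integral_of_le zero_le_one, MeasureTheory.integral_Ioc_eq_integral_Ioo]

lemma sin_pos_of_mem_Ioo {θ : ℝ} (hθ : θ ∈ Set.Ioo (0 : ℝ) (π / 2)) : 0 < Real.sin θ :=
  Real.sin_pos_of_pos_of_lt_pi hθ.1 (by linarith [hθ.2, Real.pi_pos])

lemma kell_eq_integral_ellRoot {k : ℝ} (hk : k ∈ Set.Ioo (0 : ℝ) 1) :
    Kell k = ∫ θ in (0 : ℝ)..(π / 2), (ellRoot k θ)⁻¹ := by
  have hpi : 0 < π / 2 := by positivity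
  rw [kell_eq_setIntegral, intervalIntegral.integral_of_le hpi.le,
    MeasureTheory.integral_Ioc_eq_integral_Ioo,
    integral_Ioo_comp_of_deriv_neg hpi Real.continuous_cos.continuousOn
      (fun x _ => Real.hasDerivAt_cos x) (fun x hx => by linarith [sin_pos_of_mem_Ioo hx])
      Real.cos_zero Real.cos_pi_div_two]
  refine MeasureTheory.setIntegral_congr_fun measurableSet_Ioo fun θ hθ => ?_
  have hs := sin_pos_of_mem_Ioo hθ
  have hR := ellRoot_pos hk θ
  have h1 : 1 - Real.cos θ ^ 2 = Real.sin θ ^ 2 := by linarith [Real.sin_sq_add_cos_sq θ]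
  rw [h1, Real.sqrt_mul (sq_nonneg _), Real.sqrt_sq hs.le, ← mul_pow, ← ellRoot]
  field_simp

lemma kell_eq_kell_kLanden {k : ℝ} (hk : k ∈ Set.Ioo (0 : ℝ) 1) :
    Kell k = (1 + kLanden k) * Kell (kLanden k) := by
  have hpi : 0 < π / 2 := by positivity
  have hκ := kLanden_mem hk
  have hkpos := hk.1
  have hκpos := hκ.1
  have hsq : 0 < Real.sqrt (kLanden k) := Real.sqrt_pos.2 hκ.1
  have h0 : smallRoot k 0 / Real.sqrt (kLanden k) = 1 := by
    have h1 : ellRoot k 0 = kComp k := by simp [ellRoot, kComp]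
    have := (kComp_mem hk).1
    rw [smallRoot, h1, sqrt_kLanden hk, one_add_kLanden hk, Real.cos_zero]
    field_simp
  have h1 : smallRoot k (π / 2) / Real.sqrt (kLanden k) = 0 := by simp [smallRoot]
  rw [kell_eq_integral_ellRoot hk, kell_eq_setIntegral, intervalIntegral.integral_of_le hpi.le,
    MeasureTheory.integral_Ioc_eq_integral_Ioo,
    integral_Ioo_comp_of_deriv_neg hpi
      ((continuous_smallRoot hk).div_const (Real.sqrt (kLanden k))).continuousOn
      (fun x _ => (hasDerivAt_smallRoot hk x).div_const _) (fun x hx => ?_) h0 h1,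
    ← MeasureTheory.integral_const_mul]
  · refine MeasureTheory.setIntegral_congr_fun measurableSet_Ioo fun θ hθ => ?_
    have hs := sin_pos_of_mem_Ioo hθ
    have hR := ellRoot_pos hk θ
    have h2 := sqrt_smallRoot_poly hk hs.le
    have h3 : (1 - (smallRoot k θ / Real.sqrt (kLanden k)) ^ 2) *
        (1 - kLanden k ^ 2 * (smallRoot k θ / Real.sqrt (kLanden k)) ^ 2) =
        ((kLanden k - smallRoot k θ ^ 2) * (1 - kLanden k * smallRoot k θ ^ 2)) /
          (Real.sqrt (kLanden k)) ^ 2 := by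
      rw [div_pow, Real.sq_sqrt hκ.1.le]
      field_simp
    rw [h3, Real.sqrt_div' _ (sq_nonneg _), h2, Real.sqrt_sq hsq.le]
    field_simp
  · have hs := sin_pos_of_mem_Ioo hx
    have hR := ellRoot_pos hk x
    have : 0 < k * Real.sin x / (ellRoot k x * (1 + ellRoot k x)) := by positivity
    exact div_neg_of_neg_of_pos (by linarith) hsq

lemma continuous_inv_ellRoot {k : ℝ} (hk : k ∈ Set.Ioo (0 : ℝ) 1) :
    Continuous fun θ => (ellRoot k θ)⁻¹ :=
  (continuous_ellRoot k).inv₀ fun θ => (ellRoot_pos hk θ).ne'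

lemma kell_pos {k : ℝ} (hk : k ∈ Set.Ioo (0 : ℝ) 1) : 0 < Kell k := by
  rw [kell_eq_integral_ellRoot hk]
  exact intervalIntegral.intervalIntegral_pos_of_pos
    ((continuous_inv_ellRoot hk).intervalIntegrable _ _)
    (fun θ => inv_pos.2 (ellRoot_pos hk θ)) (by positivity)

lemma kell_kComp {k : ℝ} (hk : k ∈ Set.Ioo (0 : ℝ) 1) :
    Kell (kComp k) = (1 + kLanden k) *
      ∫ y in (0 : ℝ)..1, (Real.sqrt ((kLanden k + y ^ 2) * (1 + kLanden k * y ^ 2)))⁻¹ := by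
  have hκ := kLanden_mem hk
  have hκpos := hκ.1
  have hd : ∀ y ∈ Set.Ioo (0 : ℝ) 1, HasDerivAt (fun y : ℝ => (1 - y ^ 2) / (1 + y ^ 2))
      (-(4 * y / (1 + y ^ 2) ^ 2)) y := by
    intro y _
    have h : HasDerivAt (fun y : ℝ => (1 - y ^ 2) / (1 + y ^ 2)) _ y :=
      ((hasDerivAt_pow 2 y).const_sub 1).div ((hasDerivAt_pow 2 y).const_add 1) (by positivity)
    refine h.congr_deriv (Eq.symm ?_)
    field_simp
    push_cast
    ring
  have hcont : Continuous fun y : ℝ => (1 - y ^ 2) / (1 + y ^ 2) :=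
    Continuous.div (by fun_prop) (by fun_prop) fun y => by positivity
  rw [kell_eq_setIntegral, intervalIntegral.integral_of_le zero_le_one,
    MeasureTheory.integral_Ioc_eq_integral_Ioo,
    integral_Ioo_comp_of_deriv_neg zero_lt_one hcont.continuousOn hd (fun y hy => ?_)
      (by norm_num) (by norm_num), ← MeasureTheory.integral_const_mul]
  · refine MeasureTheory.setIntegral_congr_fun measurableSet_Ioo fun y hy => ?_
    have hy0 := hy.1
    have hk' : kComp k = (1 - kLanden k) / (1 + kLanden k) := by
      have := (kComp_mem hk).1
      rw [one_add_kLanden hk, kLanden]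
      field_simp
      ring
    have h3 : (1 - ((1 - y ^ 2) / (1 + y ^ 2)) ^ 2) *
        (1 - kComp k ^ 2 * ((1 - y ^ 2) / (1 + y ^ 2)) ^ 2) =
        ((kLanden k + y ^ 2) * (1 + kLanden k * y ^ 2)) *
          (4 * y / ((1 + y ^ 2) ^ 2 * (1 + kLanden k))) ^ 2 := by
      rw [hk']
      field_simp
      ring
    rw [h3, Real.sqrt_mul (by positivity), Real.sqrt_sq (by positivity)]
    field_simp
  · have := hy.1
    have : 0 < 4 * y / (1 + y ^ 2) ^ 2 := by positivity
    linarith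

/-- The normalized amplitude `θ ↦ (4 K(k))⁻¹ ∫₀^θ (1 - k² cos² φ)^{-1/2} dφ`. -/
def ellAngle (k θ : ℝ) : ℝ := (4 * Kell k)⁻¹ * ∫ φ in (0 : ℝ)..θ, (ellRoot k φ)⁻¹

lemma hasDerivAt_ellAngle {k : ℝ} (hk : k ∈ Set.Ioo (0 : ℝ) 1) (θ : ℝ) :
    HasDerivAt (ellAngle k) ((4 * Kell k)⁻¹ * (ellRoot k θ)⁻¹) θ :=
  ((continuous_inv_ellRoot hk).integral_hasStrictDerivAt 0 θ).hasDerivAt.const_mul _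

lemma ellAngle_zero (k : ℝ) : ellAngle k 0 = 0 := by simp [ellAngle]

lemma ellAngle_pi_div_two {k : ℝ} (hk : k ∈ Set.Ioo (0 : ℝ) 1) : ellAngle k (π / 2) = 1 / 4 := by
  have := kell_pos hk
  rw [ellAngle, ← kell_eq_integral_ellRoot hk]
  field_simp

lemma ellRoot_neg (k θ : ℝ) : ellRoot k (-θ) = ellRoot k θ := by simp [ellRoot]

lemma ellRoot_add_pi (k θ : ℝ) : ellRoot k (θ + π) = ellRoot k θ := by
  simp [ellRoot, Real.cos_add_pi]

lemma ellAngle_neg (k θ : ℝ) : ellAngle k (-θ) = -ellAngle k θ := by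
  have h := intervalIntegral.integral_comp_neg (a := 0) (b := θ) fun φ => (ellRoot k φ)⁻¹
  simp only [ellRoot_neg, neg_zero] at h
  rw [ellAngle, ellAngle, h, intervalIntegral.integral_symm]
  ring

lemma ellAngle_add_pi {k : ℝ} (hk : k ∈ Set.Ioo (0 : ℝ) 1) (θ : ℝ) :
    ellAngle k (θ + π) = ellAngle k θ + 1 / 2 := by
  have hd : ∀ θ, HasDerivAt (fun θ => ellAngle k (θ + π) - ellAngle k θ) 0 θ := by
    intro θ
    have h := (((hasDerivAt_ellAngle hk (θ + π)).comp_add_const θ π)).sub (hasDerivAt_ellAngle hk θ)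
    rwa [ellRoot_add_pi, sub_self] at h
  have h := is_const_of_deriv_eq_zero (fun θ => (hd θ).differentiableAt) (fun θ => (hd θ).deriv)
    θ (-(π / 2))
  have h1 : -(π / 2) + π = π / 2 := by ring
  simp only [h1, ellAngle_neg, ellAngle_pi_div_two hk] at h
  linarith

lemma ellAngle_pi {k : ℝ} (hk : k ∈ Set.Ioo (0 : ℝ) 1) : ellAngle k π = 1 / 2 := by
  have h := ellAngle_add_pi hk 0
  rwa [zero_add, ellAngle_zero, zero_add] at h

lemma continuous_ellAngle {k : ℝ} (hk : k ∈ Set.Ioo (0 : ℝ) 1) : Continuous (ellAngle k) :=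
  continuous_iff_continuousAt.2 fun θ => (hasDerivAt_ellAngle hk θ).continuousAt

/-! ### The conformal map `v` on the real axis and on the unit circle -/

lemma mem_slitDom_of_im_ne_zero {κ : ℝ} {z : ℂ} (h : z.im ≠ 0) : z ∈ slitDom κ :=
  fun h' => h h'.1

lemma ofReal_mem_slitDom {κ x : ℝ} (h : x ^ 2 < κ) : (x : ℂ) ∈ slitDom κ := by
  intro h'
  have := h'.2
  rw [Complex.ofReal_re] at this
  linarith

lemma mul_I_mem_slitDom {κ : ℝ} (hκ : 0 < κ) (y : ℝ) : (y : ℂ) * Complex.I ∈ slitDom κ := by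
  intro h'
  have := h'.2
  simp at this
  linarith

lemma isPreconnected_slitDom {κ : ℝ} (hκ : 0 < κ) : IsPreconnected (slitDom κ) := by
  have h0 : (0 : ℂ) ∈ slitDom κ := by simpa using mul_I_mem_slitDom hκ 0
  have hs : StarConvex ℝ (0 : ℂ) (slitDom κ) := by
    rw [starConvex_zero_iff]
    rintro z hz c hc0 hc1 ⟨h1, h2⟩
    rw [Complex.smul_im, smul_eq_mul, mul_eq_zero] at h1
    rw [Complex.smul_re, smul_eq_mul, mul_pow] at h2
    rcases h1 with h1 | h1
    · rw [h1] at h2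
      norm_num at h2
      linarith
    · refine hz ⟨h1, h2.trans ?_⟩
      exact mul_le_of_le_one_left (sq_nonneg _) (pow_le_one₀ hc0 hc1)
  exact (hs.isPathConnected h0).isConnected.isPreconnected

lemma IsVmap.deriv_sq {κ : ℝ} {v : ℂ → ℂ} (hv : IsVmap κ v) (hκ : κ ∈ Set.Ioo (0 : ℝ) 1)
    (hK : 0 < Kell κ) {z : ℂ} (hz : z ∈ slitDom κ) :
    16 * (Kell κ : ℂ) ^ 2 * ((κ - z ^ 2) * (1 - κ * z ^ 2)) * deriv v z ^ 2 = 1 := by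
  have han : AnalyticOnNhd ℂ (fun z : ℂ =>
      16 * (Kell κ : ℂ) ^ 2 * ((κ - z ^ 2) * (1 - κ * z ^ 2)) * deriv v z ^ 2) (slitDom κ) := by
    have h1 : AnalyticOnNhd ℂ (fun z : ℂ =>
        16 * (Kell κ : ℂ) ^ 2 * ((κ - z ^ 2) * (1 - κ * z ^ 2))) (slitDom κ) := by
      intro z _
      fun_prop
    exact h1.mul (hv.analytic.deriv.pow 2)
  refine han.eqOn_of_preconnected_of_frequently_eq (g := fun _ => (1 : ℂ)) analyticOnNhd_const
    (isPreconnected_slitDom hκ.1)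
    (z₀ := 0) (by simpa using mul_I_mem_slitDom hκ.1 0) ?_ hz
  have htend : Filter.Tendsto (fun x : ℝ => (x : ℂ)) (nhdsWithin 0 {0}ᶜ) (nhdsWithin 0 {0}ᶜ) := by
    refine tendsto_nhdsWithin_iff.2 ⟨?_, ?_⟩
    · have : Filter.Tendsto (fun x : ℝ => (x : ℂ)) (nhds 0) (nhds ((0 : ℝ) : ℂ)) :=
        Complex.continuous_ofReal.tendsto 0
      simpa using this.mono_left nhdsWithin_le_nhds
    · filter_upwards [self_mem_nhdsWithin] with x hx
      simpa using hx
  refine htend.frequently (Filter.Eventually.frequently ?_)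
  have hlt : ∀ᶠ x : ℝ in nhds 0, x ^ 2 < κ := by
    have : Filter.Tendsto (fun x : ℝ => x ^ 2) (nhds 0) (nhds 0) := by
      simpa using (continuous_pow 2).tendsto (0 : ℝ)
    exact this.eventually_lt_const hκ.1
  filter_upwards [nhdsWithin_le_nhds hlt] with x hx
  rw [(hv.deriv_real x hx).deriv]
  have hp : 0 < (κ - x ^ 2) * (1 - κ * x ^ 2) := by
    apply mul_pos (by linarith)
    nlinarith [hκ.1, hκ.2, sq_nonneg x]
  have hsq := Real.sq_sqrt hp.le
  have hpos := Real.sqrt_pos.2 hp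
  have : 16 * (Kell κ) ^ 2 * ((κ - x ^ 2) * (1 - κ * x ^ 2)) *
      (1 / (4 * Kell κ * Real.sqrt ((κ - x ^ 2) * (1 - κ * x ^ 2)))) ^ 2 = 1 := by
    rw [div_pow, mul_pow, hsq]
    generalize (κ - x ^ 2) * (1 - κ * x ^ 2) = P at hp
    field_simp
    norm_num
  exact_mod_cast this

lemma eq_of_hasDerivAt_eq_on_Ioo {f g f' : ℝ → ℂ} {a b c : ℝ}
    (hf : ∀ x ∈ Set.Ioo a b, HasDerivAt f (f' x) x)
    (hg : ∀ x ∈ Set.Ioo a b, HasDerivAt g (f' x) x) (hc : c ∈ Set.Ioo a b) (hfg : f c = g c)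
    {x : ℝ} (hx : x ∈ Set.Ioo a b) : f x = g x := by
  refine isOpen_Ioo.eqOn_of_deriv_eq isPreconnected_Ioo
    (fun y hy => (hf y hy).differentiableAt.differentiableWithinAt)
    (fun y hy => (hg y hy).differentiableAt.differentiableWithinAt) (fun y hy => ?_) hc hfg hx
  rw [(hf y hy).deriv, (hg y hy).deriv]

lemma pi_div_two_mem : π / 2 ∈ Set.Ioo (0 : ℝ) π :=
  ⟨by linarith [Real.pi_pos], by linarith [Real.pi_pos]⟩

lemma IsVmap.apply_smallRoot {k : ℝ} (hk : k ∈ Set.Ioo (0 : ℝ) 1) {v : ℂ → ℂ}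
    (hv : IsVmap (kLanden k) v) {θ : ℝ} (hθ : θ ∈ Set.Ioo 0 π) :
    v (smallRoot k θ) = 1 / 4 - ellAngle k θ := by
  have hκ := kLanden_mem hk
  have hkpos := hk.1
  have hκpos := hκ.1
  have hK := kell_pos hκ
  refine eq_of_hasDerivAt_eq_on_Ioo (f := fun θ : ℝ => v (smallRoot k θ))
    (g := fun θ : ℝ => 1 / 4 - (ellAngle k θ : ℂ))
    (f' := fun θ => ((-((4 * Kell k)⁻¹ * (ellRoot k θ)⁻¹) : ℝ) : ℂ)) ?_ ?_ pi_div_two_mem ?_ hθ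
  · intro x hx
    have hs := Real.sin_pos_of_pos_of_lt_pi hx.1 hx.2
    have hR := ellRoot_pos hk x
    have h := (hv.deriv_real _ (smallRoot_sq_lt hk hs)).comp_ofReal.scomp x
      (hasDerivAt_smallRoot hk x)
    refine HasDerivAt.congr_deriv h ?_
    rw [sqrt_smallRoot_poly hk hs.le, kell_eq_kell_kLanden hk, Complex.real_smul,
      ← Complex.ofReal_mul]
    congr 1
    field_simp
  · intro x _
    have h := ((hasDerivAt_ellAngle hk x).ofReal_comp).const_sub (1 / 4 : ℂ)
    refine HasDerivAt.congr_deriv h ?_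
    push_cast
    ring
  · have : smallRoot k (π / 2) = 0 := by simp [smallRoot]
    simp only [this, ellAngle_pi_div_two hk]
    simp [hv.map_zero]

lemma IsVmap.deriv_mul_I {κ : ℝ} {v : ℂ → ℂ} (hv : IsVmap κ v) (hκ : κ ∈ Set.Ioo (0 : ℝ) 1)
    (hK : 0 < Kell κ) (y : ℝ) : deriv v (y * Complex.I) =
      (((4 * Kell κ)⁻¹ * (Real.sqrt ((κ + y ^ 2) * (1 + κ * y ^ 2)))⁻¹ : ℝ) : ℂ) := by
  have hκpos := hκ.1
  set g : ℝ → ℝ := fun y => (Real.sqrt ((κ + y ^ 2) * (1 + κ * y ^ 2)))⁻¹ with hg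
  have hpos : ∀ y : ℝ, 0 < (κ + y ^ 2) * (1 + κ * y ^ 2) := fun y => by positivity
  have hgpos : ∀ y, 0 < g y := fun y => inv_pos.2 (Real.sqrt_pos.2 (hpos y))
  have hgc : Continuous g :=
    Continuous.inv₀ (by fun_prop) fun y => (Real.sqrt_pos.2 (hpos y)).ne'
  have hdc : Continuous fun y : ℝ => deriv v (y * Complex.I) := by
    rw [continuous_iff_continuousAt]
    intro y
    have h1 : ContinuousAt (deriv v) ((y : ℂ) * Complex.I) :=
      (hv.analytic.deriv _ (mul_I_mem_slitDom hκ.1 y)).continuousAt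
    exact ContinuousAt.comp (f := fun y : ℝ => (y : ℂ) * Complex.I) h1 (by fun_prop)
  refine isPreconnected_univ.eq_of_sq_eq (f := fun y : ℝ => deriv v (y * Complex.I))
    (g := fun y : ℝ => (((4 * Kell κ)⁻¹ * g y : ℝ) : ℂ)) hdc.continuousOn
    (by fun_prop) ?_ ?_ (Set.mem_univ 0) ?_ (Set.mem_univ y)
  · intro y _
    have h1 := hv.deriv_sq hκ hK (mul_I_mem_slitDom hκ.1 y)
    have h2 : 16 * Kell κ ^ 2 * ((κ + y ^ 2) * (1 + κ * y ^ 2)) *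
        ((4 * Kell κ)⁻¹ * g y) ^ 2 = 1 := by
      simp only [hg]
      rw [mul_pow, inv_pow, inv_pow, Real.sq_sqrt (hpos y).le]
      have := hpos y
      field_simp
      norm_num
    simp only [Pi.pow_apply]
    have h3 : ((16 * Kell κ ^ 2 * ((κ + y ^ 2) * (1 + κ * y ^ 2)) : ℝ) : ℂ) ≠ 0 := by
      have := hpos y
      exact_mod_cast (by positivity : (16 * Kell κ ^ 2 * ((κ + y ^ 2) * (1 + κ * y ^ 2))) ≠ 0)
    apply mul_left_cancel₀ h3
    rw [← Complex.ofReal_pow ((4 * Kell κ)⁻¹ * g y), ← Complex.ofReal_mul _ (_ ^ 2), h2,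
      Complex.ofReal_one, ← h1, mul_pow, Complex.I_sq]
    push_cast
    ring
  · intro y _
    exact_mod_cast (mul_pos (by positivity) (hgpos y)).ne'
  · have h := (hv.deriv_real 0 (by simpa using hκ.1)).deriv
    simp only [Complex.ofReal_zero, zero_mul] at h ⊢
    rw [h]
    congr 1
    simp only [hg]
    norm_num
    ring

lemma IsVmap.apply_I {k : ℝ} (hk : k ∈ Set.Ioo (0 : ℝ) 1) {v : ℂ → ℂ}
    (hv : IsVmap (kLanden k) v) : v Complex.I = Tell k * Complex.I := by
  have hκ := kLanden_mem hk
  have hκpos := hκ.1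
  have hK := kell_pos hκ
  set κ := kLanden k with hκdef
  set g : ℝ → ℝ := fun y => (Real.sqrt ((κ + y ^ 2) * (1 + κ * y ^ 2)))⁻¹ with hg
  have hpos : ∀ y : ℝ, 0 < (κ + y ^ 2) * (1 + κ * y ^ 2) := fun y => by positivity
  have hgc : Continuous g :=
    Continuous.inv₀ (by fun_prop) fun y => (Real.sqrt_pos.2 (hpos y)).ne'
  have hderiv : ∀ y : ℝ, deriv v (y * Complex.I) = (((4 * Kell κ)⁻¹ * g y : ℝ) : ℂ) :=
    hv.deriv_mul_I hκ hK
  have hd : ∀ y ∈ Set.uIcc (0 : ℝ) 1, HasDerivAt (fun y : ℝ => v (y * Complex.I))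
      ((((4 * Kell κ)⁻¹ * g y : ℝ) : ℂ) * Complex.I) y := by
    intro y _
    have h1 := (hv.analytic _ (mul_I_mem_slitDom hκ.1 y)).differentiableAt.hasDerivAt
    have h2 : HasDerivAt (fun y : ℂ => y * Complex.I) Complex.I y := by
      simpa using (hasDerivAt_id (y : ℂ)).mul_const Complex.I
    have h3 := (HasDerivAt.comp (y : ℂ) h1 h2).comp_ofReal
    rw [hderiv] at h3
    exact h3
  have hint := intervalIntegral.integral_eq_sub_of_hasDerivAt hd
    (Continuous.intervalIntegrable (by fun_prop) _ _)
  simp only [Complex.ofReal_one, one_mul, Complex.ofReal_zero, zero_mul, hv.map_zero, sub_zero]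
    at hint
  rw [← hint, intervalIntegral.integral_mul_const, intervalIntegral.integral_ofReal,
    intervalIntegral.integral_const_mul, Tell, kell_kComp hk, kell_eq_kell_kLanden hk]
  congr 2
  change (4 * Kell κ)⁻¹ * (∫ y in (0 : ℝ)..1, g y) =
    (1 + κ) * (∫ y in (0 : ℝ)..1, g y) / (4 * ((1 + κ) * Kell κ))
  field_simp

lemma exp_mul_I_im (θ : ℝ) : (Complex.exp (θ * Complex.I)).im = Real.sin θ := by
  rw [Complex.exp_ofReal_mul_I_im]

lemma mul_exp_mem_slitDom {κ r θ : ℝ} (hr : 0 < r) (hθ : θ ∈ Set.Ioo 0 π) :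
    (r : ℂ) * Complex.exp (θ * Complex.I) ∈ slitDom κ := by
  apply mem_slitDom_of_im_ne_zero
  rw [Complex.im_ofReal_mul, exp_mul_I_im]
  exact (mul_pos hr (Real.sin_pos_of_pos_of_lt_pi hθ.1 hθ.2)).ne'

lemma exp_mem_slitDom {κ θ : ℝ} (hθ : θ ∈ Set.Ioo 0 π) :
    Complex.exp (θ * Complex.I) ∈ slitDom κ := by
  simpa using mul_exp_mem_slitDom (κ := κ) one_pos hθ

lemma IsVmap.hasDerivAt_arc {κ : ℝ} {v : ℂ → ℂ} (hv : IsVmap κ v) {r θ : ℝ} (hr : 0 < r)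
    (hθ : θ ∈ Set.Ioo 0 π) :
    HasDerivAt (fun θ : ℝ => v (r * Complex.exp (θ * Complex.I)))
      (deriv v (r * Complex.exp (θ * Complex.I)) * (r * Complex.exp (θ * Complex.I) * Complex.I))
      θ := by
  have h1 := (hv.analytic _ (mul_exp_mem_slitDom hr hθ)).differentiableAt.hasDerivAt
  have h2 : HasDerivAt (fun θ : ℂ => (r : ℂ) * Complex.exp (θ * Complex.I))
      (r * Complex.exp (θ * Complex.I) * Complex.I) θ := by
    have := (((hasDerivAt_id (θ : ℂ)).mul_const Complex.I).cexp).const_mul (r : ℂ)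
    simpa [mul_assoc] using this
  exact (HasDerivAt.comp (θ : ℂ) h1 h2).comp_ofReal

lemma IsVmap.apply_exp {k : ℝ} (hk : k ∈ Set.Ioo (0 : ℝ) 1) {v : ℂ → ℂ}
    (hv : IsVmap (kLanden k) v) {θ : ℝ} (hθ : θ ∈ Set.Ioo 0 π) :
    v (Complex.exp (θ * Complex.I)) = 1 / 4 - ellAngle k θ + Tell k * Complex.I := by
  have hκ := kLanden_mem hk
  have hκpos := hκ.1
  have hK := kell_pos hκ
  have hKk := kell_pos hk
  have hexpI : Complex.exp (((π / 2 : ℝ) : ℂ) * Complex.I) = Complex.I := by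
    push_cast
    exact Complex.exp_pi_div_two_mul_I
  refine eq_of_hasDerivAt_eq_on_Ioo (f := fun θ : ℝ => v (Complex.exp (θ * Complex.I)))
    (g := fun θ : ℝ => 1 / 4 - (ellAngle k θ : ℂ) + Tell k * Complex.I)
    (f' := fun θ => ((-((4 * Kell k)⁻¹ * (ellRoot k θ)⁻¹) : ℝ) : ℂ)) ?_ ?_ pi_div_two_mem ?_ hθ
  · intro x hx
    have h := hv.hasDerivAt_arc one_pos hx
    simp only [Complex.ofReal_one, one_mul] at h
    refine HasDerivAt.congr_deriv h ?_
    refine isPreconnected_Ioo.eq_of_sq_eq (S := Set.Ioo 0 π) (y := π / 2)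
      (f := fun θ : ℝ => deriv v (Complex.exp (θ * Complex.I)) *
        (Complex.exp (θ * Complex.I) * Complex.I))
      (g := fun θ => ((-((4 * Kell k)⁻¹ * (ellRoot k θ)⁻¹) : ℝ) : ℂ)) ?_ ?_ ?_ ?_
      pi_div_two_mem ?_ hx
    · intro y hy
      apply ContinuousAt.continuousWithinAt
      have h1 : ContinuousAt (deriv v) (Complex.exp (y * Complex.I)) :=
        (hv.analytic.deriv _ (exp_mem_slitDom hy)).continuousAt
      exact ContinuousAt.mul (ContinuousAt.comp (f := fun y : ℝ => Complex.exp (y * Complex.I)) h1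
        (by fun_prop)) (by fun_prop)
    · exact (Complex.continuous_ofReal.comp
        ((continuous_inv_ellRoot hk).const_mul _).neg).continuousOn
    · intro y hy
      have h1 := hv.deriv_sq hκ hK (exp_mem_slitDom hy)
      have hR := ellRoot_pos hk y
      have h2 : 16 * Kell k ^ 2 * (ellRoot k y) ^ 2 *
          (-((4 * Kell k)⁻¹ * (ellRoot k y)⁻¹)) ^ 2 = 1 := by
        field_simp
        norm_num
      have h3 : ((16 * Kell k ^ 2 * (ellRoot k y) ^ 2 : ℝ) : ℂ) ≠ 0 := by
        exact_mod_cast (by positivity : (16 * Kell k ^ 2 * (ellRoot k y) ^ 2) ≠ 0)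
      simp only [Pi.pow_apply]
      apply mul_left_cancel₀ h3
      rw [← Complex.ofReal_pow (-_), ← Complex.ofReal_mul _ (_ ^ 2), h2, Complex.ofReal_one, ← h1]
      have h4 := ellRoot_sq hk y
      have h5 : (1 + kLanden k) ^ 2 * ellRoot k y ^ 2 =
          (1 + kLanden k) ^ 2 - 4 * kLanden k * Real.cos y ^ 2 := by
        rw [h4, four_mul_kLanden hk]
        ring
      rw [kell_eq_kell_kLanden hk]
      have h6 : (16 * ((1 + kLanden k) * Kell (kLanden k)) ^ 2 * ellRoot k y ^ 2 : ℝ) =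
          16 * Kell (kLanden k) ^ 2 *
            ((1 + kLanden k) ^ 2 - 4 * kLanden k * Real.cos y ^ 2) := by
        rw [← h5]
        ring
      rw [h6]
      push_cast
      have h7 : Complex.exp (y * Complex.I) ^ 2 - 2 * Complex.cos y * Complex.exp (y * Complex.I)
          + 1 = 0 := by
        rw [Complex.exp_mul_I]
        linear_combination Complex.sin_sq_add_cos_sq (y : ℂ) * (-1)
          + Complex.sin (y : ℂ) ^ 2 * Complex.I_sq
      set z := Complex.exp (y * Complex.I)
      set K : ℂ := (Kell (kLanden k) : ℂ)
      set κ : ℂ := (kLanden k : ℂ)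
      set D := deriv v z
      set c := Complex.cos y
      linear_combination (16 * K ^ 2 * D ^ 2 * ((1 + κ) ^ 2 - 4 * κ * c ^ 2) * z ^ 2) *
        Complex.I_sq - 16 * K ^ 2 * D ^ 2 * κ * (z ^ 2 + 2 * c * z + 1) * h7
    · intro y _
      have hR := ellRoot_pos hk y
      have : 0 < (4 * Kell k)⁻¹ * (ellRoot k y)⁻¹ := by positivity
      exact_mod_cast (by linarith : -((4 * Kell k)⁻¹ * (ellRoot k y)⁻¹) < 0).ne
    · have h1 := hv.deriv_mul_I hκ hK 1
      have h2 : (kLanden k + 1 ^ 2) * (1 + kLanden k * 1 ^ 2) = (1 + kLanden k) ^ 2 := by ring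
      have h3 : ellRoot k (π / 2) = 1 := by simp [ellRoot]
      rw [h2, Real.sqrt_sq (by linarith), ← mul_inv, Complex.ofReal_one, one_mul] at h1
      simp only [hexpI]
      rw [h1, h3, Complex.I_mul_I, kell_eq_kell_kLanden hk]
      push_cast
      ring
  · intro x _
    have h := (((hasDerivAt_ellAngle hk x).ofReal_comp).const_sub (1 / 4 : ℂ)).add_const
      (Tell k * Complex.I)
    refine HasDerivAt.congr_deriv h ?_
    push_cast
    ring
  · simp only [hexpI, ellAngle_pi_div_two hk, hv.apply_I hk]
    push_cast
    ring

/-! ### Boundary values and Fourier coefficients -/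

lemma hasSum_integral_zero_pi {F : ℕ → ℝ → ℝ} {B : ℕ → ℝ} {f : ℝ → ℝ}
    (hF : ∀ j, Continuous (F j)) (hB : Summable B) (hFB : ∀ j, ∀ θ ∈ Set.Ioo 0 π, |F j θ| ≤ B j)
    (h : ∀ θ ∈ Set.Ioo 0 π, HasSum (fun j => F j θ) (f θ)) :
    HasSum (fun j => ∫ θ in (0 : ℝ)..π, F j θ) (∫ θ in (0 : ℝ)..π, f θ) := by
  refine intervalIntegral.hasSum_integral_of_dominated_convergence (fun j _ => B j)
    (fun j => (hF j).aestronglyMeasurable) (fun j => ?_) ?_ intervalIntegrable_const ?_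
  · filter_upwards [MeasureTheory.Measure.ae_ne MeasureTheory.volume π] with θ hne hθ
    rw [Set.uIoc_of_le Real.pi_pos.le] at hθ
    exact hFB j θ ⟨hθ.1, lt_of_le_of_ne hθ.2 hne⟩
  · filter_upwards with θ _ using hB
  · filter_upwards [MeasureTheory.Measure.ae_ne MeasureTheory.volume π] with θ hne hθ
    rw [Set.uIoc_of_le Real.pi_pos.le] at hθ
    exact h θ ⟨hθ.1, lt_of_le_of_ne hθ.2 hne⟩

lemma integral_cos_mul_cos (j : ℕ) {n : ℕ} (hn : 1 ≤ n) :
    ∫ θ in (0 : ℝ)..π, Real.cos (j * θ) * Real.cos (n * θ) = if j = n then π / 2 else 0 := by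
  have h1 : ∀ θ : ℝ, Real.cos (j * θ) * Real.cos (n * θ) =
      2⁻¹ * (Real.cos (((j - n : ℤ) : ℝ) * θ) + Real.cos (((j + n : ℤ) : ℝ) * θ)) := by
    intro θ
    push_cast
    rw [sub_mul, add_mul, Real.cos_sub, Real.cos_add]
    ring
  simp_rw [h1]
  rw [intervalIntegral.integral_const_mul, intervalIntegral.integral_add
    (Continuous.intervalIntegrable (by fun_prop) _ _)
    (Continuous.intervalIntegrable (by fun_prop) _ _), integral_cos_int_mul, integral_cos_int_mul,
    if_neg (show (j + n : ℤ) ≠ 0 by omega)]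
  by_cases h : j = n
  · simp [h]; ring
  · rw [if_neg h, if_neg (by omega)]; simp

lemma integral_sin_mul_sin (j : ℕ) {n : ℕ} (hn : 1 ≤ n) :
    ∫ θ in (0 : ℝ)..π, Real.sin (j * θ) * Real.sin (n * θ) = if j = n then π / 2 else 0 := by
  have h1 : ∀ θ : ℝ, Real.sin (j * θ) * Real.sin (n * θ) =
      2⁻¹ * (Real.cos (((j - n : ℤ) : ℝ) * θ) - Real.cos (((j + n : ℤ) : ℝ) * θ)) := by
    intro θ
    push_cast
    rw [sub_mul, add_mul, Real.cos_sub, Real.cos_add]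
    ring
  simp_rw [h1]
  rw [intervalIntegral.integral_const_mul, intervalIntegral.integral_sub
    (Continuous.intervalIntegrable (by fun_prop) _ _)
    (Continuous.intervalIntegrable (by fun_prop) _ _), integral_cos_int_mul, integral_cos_int_mul,
    if_neg (show (j + n : ℤ) ≠ 0 by omega)]
  by_cases h : j = n
  · simp [h]; ring
  · rw [if_neg h, if_neg (by omega)]; simp

lemma integral_mul_cos_of_hasSum {b : ℕ → ℝ} (hb : Summable fun j => |b j|) {f : ℝ → ℝ}
    (h : ∀ θ ∈ Set.Ioo 0 π, HasSum (fun j : ℕ => b j * Real.cos (j * θ)) (f θ)) {n : ℕ}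
    (hn : 1 ≤ n) : ∫ θ in (0 : ℝ)..π, f θ * Real.cos (n * θ) = π / 2 * b n := by
  have h1 := hasSum_integral_zero_pi (F := fun j θ => b j * Real.cos (j * θ) * Real.cos (n * θ))
    (f := fun θ => f θ * Real.cos (n * θ)) (fun j => by fun_prop) hb (fun j θ _ => ?_)
    (fun θ hθ => (h θ hθ).mul_right _)
  · simp_rw [mul_assoc, intervalIntegral.integral_const_mul, integral_cos_mul_cos _ hn] at h1
    refine h1.unique ?_
    convert hasSum_ite_eq n (π / 2 * b n) using 2 with j
    split_ifs with hj <;> simp [hj, mul_comm]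
  · rw [abs_mul, abs_mul, mul_assoc]
    exact mul_le_of_le_one_right (abs_nonneg _)
      (mul_le_one₀ (Real.abs_cos_le_one _) (abs_nonneg _) (Real.abs_cos_le_one _))

lemma integral_mul_sin_of_hasSum {b : ℕ → ℝ} (hb : Summable fun j => |b j|) {f : ℝ → ℝ}
    (h : ∀ θ ∈ Set.Ioo 0 π, HasSum (fun j : ℕ => b j * Real.sin (j * θ)) (f θ)) {n : ℕ}
    (hn : 1 ≤ n) : ∫ θ in (0 : ℝ)..π, f θ * Real.sin (n * θ) = π / 2 * b n := by
  have h1 := hasSum_integral_zero_pi (F := fun j θ => b j * Real.sin (j * θ) * Real.sin (n * θ))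
    (f := fun θ => f θ * Real.sin (n * θ)) (fun j => by fun_prop) hb (fun j θ _ => ?_)
    (fun θ hθ => (h θ hθ).mul_right _)
  · simp_rw [mul_assoc, intervalIntegral.integral_const_mul, integral_sin_mul_sin _ hn] at h1
    refine h1.unique ?_
    convert hasSum_ite_eq n (π / 2 * b n) using 2 with j
    split_ifs with hj <;> simp [hj, mul_comm]
  · rw [abs_mul, abs_mul, mul_assoc]
    exact mul_le_of_le_one_right (abs_nonneg _)
      (mul_le_one₀ (Real.abs_sin_le_one _) (abs_nonneg _) (Real.abs_sin_le_one _))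

section Coeff

variable {κ : ℝ} {v : ℂ → ℂ} {a : ℕ → ℕ → ℝ}

lemma IsCoeff.summable_abs (ha : IsCoeff κ v a) (hκ : 0 < κ) {m : ℕ} (hm : 1 ≤ m) {r : ℝ}
    (hr0 : 0 < r) (hr1 : r < 1) : Summable fun n => |a n m * r ^ n| := by
  have h := (ha m hm (r * Complex.I) (mul_I_mem_slitDom hκ r)
    (by simpa [abs_of_pos hr0] using hr1)).summable.norm
  refine h.congr fun n => ?_
  simp [abs_mul, abs_of_pos hr0]

lemma ofReal_mul_mul_exp_pow (x r θ : ℝ) (n : ℕ) :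
    (x : ℂ) * (r * Complex.exp (θ * Complex.I)) ^ n =
      ((x * r ^ n : ℝ) : ℂ) * Complex.exp ((n * θ : ℝ) * Complex.I) := by
  rw [mul_pow, ← Complex.exp_nat_mul]
  push_cast
  ring_nf

lemma IsCoeff.hasSum_re (ha : IsCoeff κ v a) {m : ℕ} (hm : 1 ≤ m) {r θ : ℝ} (hr0 : 0 < r)
    (hr1 : r < 1) (hθ : θ ∈ Set.Ioo 0 π) :
    HasSum (fun n : ℕ => a n m * r ^ n * Real.cos (n * θ))
      (fmFun v m (r * Complex.exp (θ * Complex.I))).re := by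
  have h := Complex.hasSum_re (ha m hm _ (mul_exp_mem_slitDom hr0 hθ)
    (by simpa [abs_of_pos hr0, Complex.norm_exp_ofReal_mul_I] using hr1))
  simpa only [ofReal_mul_mul_exp_pow, Complex.re_ofReal_mul, Complex.exp_ofReal_mul_I_re] using h

lemma IsCoeff.hasSum_im (ha : IsCoeff κ v a) {m : ℕ} (hm : 1 ≤ m) {r θ : ℝ} (hr0 : 0 < r)
    (hr1 : r < 1) (hθ : θ ∈ Set.Ioo 0 π) :
    HasSum (fun n : ℕ => a n m * r ^ n * Real.sin (n * θ))
      (fmFun v m (r * Complex.exp (θ * Complex.I))).im := by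
  have h := Complex.hasSum_im (ha m hm _ (mul_exp_mem_slitDom hr0 hθ)
    (by simpa [abs_of_pos hr0, Complex.norm_exp_ofReal_mul_I] using hr1))
  simpa only [ofReal_mul_mul_exp_pow, Complex.im_ofReal_mul, Complex.exp_ofReal_mul_I_im] using h

lemma IsCoeff.zero_eq_zero (ha : IsCoeff κ v a) (hv : IsVmap κ v) (hκ : 0 < κ) {m : ℕ}
    (hm : 1 ≤ m) : a 0 m = 0 := by
  have h := ha m hm 0 (by simpa using mul_I_mem_slitDom hκ 0) (by simp)
  have h1 : fmFun v m 0 = 0 := by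
    rw [fmFun, hv.map_zero, sub_eq_zero]
    congr 1
    ring
  have h2 := h.unique (hasSum_single 0 fun n hn => by simp [hn])
  simpa [h1] using h2.symm

lemma IsVmap.norm_deriv_le (hv : IsVmap κ v) (hκ : κ ∈ Set.Ioo (0 : ℝ) 1) (hK : 0 < Kell κ)
    {z : ℂ} (hz : z ∈ slitDom κ) (hz1 : ‖z‖ ≤ 1) (hz2 : (1 + κ) / 2 ≤ ‖z‖ ^ 2) :
    ‖deriv v z‖ ≤ 1 + (8 * Kell κ ^ 2 * (1 - κ) ^ 2)⁻¹ := by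
  have h := congrArg norm (hv.deriv_sq hκ hK hz)
  simp only [norm_mul, norm_pow, Complex.norm_real, norm_one, Real.norm_eq_abs, sq_abs] at h
  have h1 : (1 - κ) / 2 ≤ ‖(κ : ℂ) - z ^ 2‖ := by
    have := norm_sub_norm_le (z ^ 2) (κ : ℂ)
    rw [norm_sub_rev, norm_pow, Complex.norm_real, Real.norm_eq_abs, abs_of_pos hκ.1] at this
    linarith
  have h2 : 1 - κ ≤ ‖1 - (κ : ℂ) * z ^ 2‖ := by
    have := norm_sub_norm_le (1 : ℂ) ((κ : ℂ) * z ^ 2)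
    rw [norm_mul, norm_pow, Complex.norm_real, Real.norm_eq_abs, abs_of_pos hκ.1, norm_one] at this
    nlinarith [hκ.1, pow_le_one₀ (n := 2) (norm_nonneg z) hz1]
  have hpos : 0 < 1 - κ := by linarith [hκ.2]
  have h3 : (1 - κ) / 2 * (1 - κ) ≤ ‖(κ : ℂ) - z ^ 2‖ * ‖1 - (κ : ℂ) * z ^ 2‖ := by gcongr
  have h4 : ‖deriv v z‖ ^ 2 ≤ (8 * Kell κ ^ 2 * (1 - κ) ^ 2)⁻¹ := by
    rw [← one_div, le_div_iff₀ (by positivity)]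
    have h16 : ‖(16 : ℂ)‖ = 16 := by simp
    rw [h16] at h
    have h5 := mul_le_mul_of_nonneg_left h3
      (show 0 ≤ 16 * Kell κ ^ 2 * ‖deriv v z‖ ^ 2 by positivity)
    nlinarith
  nlinarith [sq_nonneg (‖deriv v z‖ - 1), norm_nonneg (deriv v z)]

lemma IsVmap.exists_norm_le (hv : IsVmap κ v) (hκ : κ ∈ Set.Ioo (0 : ℝ) 1) (hK : 0 < Kell κ) :
    ∃ C, ∀ᶠ r : ℝ in nhdsWithin 1 (Set.Iio 1), ∀ θ ∈ Set.Ioo 0 π,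
      ‖v (r * Complex.exp (θ * Complex.I))‖ ≤ C := by
  set D := 1 + (8 * Kell κ ^ 2 * (1 - κ) ^ 2)⁻¹ with hD
  have hD0 : 0 ≤ D := by positivity
  refine ⟨D * π + (‖v Complex.I‖ + 1), ?_⟩
  have hI : Filter.Tendsto (fun r : ℝ => ‖v (r * Complex.I)‖) (nhdsWithin 1 (Set.Iio 1))
      (nhds ‖v Complex.I‖) := by
    have h1 : ContinuousAt (fun r : ℝ => ‖v (r * Complex.I)‖) 1 := by
      refine ContinuousAt.norm (ContinuousAt.comp (g := v) (f := fun r : ℝ => (r : ℂ) * Complex.I)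
        (hv.analytic _ (mul_I_mem_slitDom hκ.1 1)).continuousAt (by fun_prop))
    simpa [ContinuousAt] using h1.tendsto.mono_left nhdsWithin_le_nhds
  have hsq : ∀ᶠ r : ℝ in nhdsWithin 1 (Set.Iio 1), (1 + κ) / 2 ≤ r ^ 2 := by
    have h1 : Filter.Tendsto (fun r : ℝ => r ^ 2) (nhdsWithin 1 (Set.Iio 1)) (nhds (1 ^ 2)) :=
      (continuous_pow 2).continuousAt.tendsto.mono_left nhdsWithin_le_nhds
    exact h1.eventually (eventually_ge_nhds (by linarith [hκ.2]))
  have h01 : ∀ᶠ r : ℝ in nhdsWithin 1 (Set.Iio 1), r ∈ Set.Ioo (0 : ℝ) 1 :=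
    Ioo_mem_nhdsLT one_pos
  filter_upwards [hI.eventually (eventually_le_nhds (lt_add_one _)), hsq, h01] with r h1 h2 h3 θ hθ
  have hnorm : ∀ x : ℝ, ‖(r : ℂ) * Complex.exp (x * Complex.I)‖ = r := fun x => by
    simp [Complex.norm_exp_ofReal_mul_I, abs_of_pos h3.1]
  have hmv := (convex_Ioo 0 π).norm_image_sub_le_of_norm_hasDerivWithin_le
    (f := fun θ : ℝ => v (r * Complex.exp (θ * Complex.I))) (C := D)
    (fun x hx => (hv.hasDerivAt_arc h3.1 hx).hasDerivWithinAt) (fun x hx => ?_)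
    pi_div_two_mem hθ
  · have hexpI : Complex.exp (((π / 2 : ℝ) : ℂ) * Complex.I) = Complex.I := by
      push_cast
      exact Complex.exp_pi_div_two_mul_I
    simp only [hexpI] at hmv
    have h4 : ‖θ - π / 2‖ ≤ π := by
      rw [Real.norm_eq_abs, abs_le]
      constructor <;> linarith [hθ.1, hθ.2]
    have h5 := norm_le_norm_sub_add (v (r * Complex.exp (θ * Complex.I))) (v (r * Complex.I))
    have h6 := mul_le_mul_of_nonneg_left h4 hD0
    linarith
  · rw [norm_mul, norm_mul, hnorm, Complex.norm_I, mul_one]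
    have h4 := hv.norm_deriv_le hκ hK (mul_exp_mem_slitDom h3.1 hx) (by rw [hnorm]; exact h3.2.le)
      (by rw [hnorm]; exact h2)
    calc _ ≤ D * 1 := mul_le_mul h4 h3.2.le h3.1.le hD0
      _ = D := mul_one _

lemma norm_cos_le_exp (z : ℂ) : ‖Complex.cos z‖ ≤ Real.exp ‖z‖ := by
  rw [Complex.cos, norm_div, Complex.norm_ofNat]
  have h1 := Complex.norm_exp_le_exp_norm (z * Complex.I)
  have h2 := Complex.norm_exp_le_exp_norm (-z * Complex.I)
  simp only [norm_mul, norm_neg, Complex.norm_I, mul_one] at h1 h2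
  have h3 := norm_add_le (Complex.exp (z * Complex.I)) (Complex.exp (-z * Complex.I))
  rw [div_le_iff₀ two_pos]
  linarith

lemma IsVmap.exists_norm_fmFun_le (hv : IsVmap κ v) (hκ : κ ∈ Set.Ioo (0 : ℝ) 1)
    (hK : 0 < Kell κ) (m : ℕ) :
    ∃ C, ∀ᶠ r : ℝ in nhdsWithin 1 (Set.Iio 1), ∀ θ ∈ Set.Ioo 0 π,
      ‖fmFun v m (r * Complex.exp (θ * Complex.I))‖ ≤ C := by
  obtain ⟨C, hC⟩ := hv.exists_norm_le hκ hK
  refine ⟨Real.exp (2 * π * m * (C + 1 / 4)) + ‖Complex.cos ((π : ℂ) * m / 2)‖, ?_⟩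
  filter_upwards [hC] with r hr θ hθ
  refine (norm_sub_le _ _).trans ?_
  gcongr
  refine (norm_cos_le_exp _).trans ?_
  rw [Real.exp_le_exp]
  have h1 : ‖(2 * (π : ℂ) * m)‖ = 2 * π * m := by
    simp [abs_of_pos Real.pi_pos]
  rw [norm_mul, h1]
  refine mul_le_mul_of_nonneg_left ((norm_add_le _ _).trans ?_) (by positivity)
  have h2 : ‖(1 / 4 : ℂ)‖ = 1 / 4 := by simp
  rw [h2]
  linarith [hr θ hθ]

lemma IsVmap.continuousAt_fmFun (hv : IsVmap κ v) (m : ℕ) {z : ℂ} (hz : z ∈ slitDom κ) :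
    ContinuousAt (fmFun v m) z := by
  have h := (hv.analytic z hz).continuousAt
  unfold fmFun
  exact (ContinuousAt.sub (Complex.continuous_cos.continuousAt.comp
    (f := fun z => 2 * (π : ℂ) * m * (v z + 1 / 4)) (by fun_prop)) continuousAt_const)

lemma IsVmap.tendsto_integral (hv : IsVmap κ v) (hκ : κ ∈ Set.Ioo (0 : ℝ) 1)
    (hK : 0 < Kell κ) (m : ℕ) {L : ℂ → ℝ} (hL : Continuous L) (hL1 : ∀ z, |L z| ≤ ‖z‖)
    {g : ℝ → ℝ} (hg : Continuous g) (hg1 : ∀ θ, |g θ| ≤ 1) :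
    Filter.Tendsto (fun r : ℝ => ∫ θ in (0 : ℝ)..π,
      L (fmFun v m (r * Complex.exp (θ * Complex.I))) * g θ) (nhdsWithin 1 (Set.Iio 1))
      (nhds (∫ θ in (0 : ℝ)..π, L (fmFun v m (Complex.exp (θ * Complex.I))) * g θ)) := by
  obtain ⟨C, hC⟩ := hv.exists_norm_fmFun_le hκ hK m
  have h01 : ∀ᶠ r : ℝ in nhdsWithin 1 (Set.Iio 1), r ∈ Set.Ioo (0 : ℝ) 1 :=
    Ioo_mem_nhdsLT one_pos
  refine intervalIntegral.tendsto_integral_filter_of_dominated_convergence (fun _ => C) ?_ ?_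
    intervalIntegrable_const ?_
  · filter_upwards [h01] with r hr
    rw [Set.uIoc_of_le Real.pi_pos.le, ← MeasureTheory.restrict_Ioo_eq_restrict_Ioc]
    refine ContinuousOn.aestronglyMeasurable (fun θ hθ => ContinuousAt.continuousWithinAt ?_)
      measurableSet_Ioo
    exact (hL.continuousAt.comp (f := fun θ : ℝ => fmFun v m (r * Complex.exp (θ * Complex.I)))
      (ContinuousAt.comp (f := fun θ : ℝ => (r : ℂ) * Complex.exp (θ * Complex.I))
      (hv.continuousAt_fmFun m (mul_exp_mem_slitDom hr.1 hθ)) (by fun_prop))).mul hg.continuousAt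
  · filter_upwards [hC] with r hr
    filter_upwards [MeasureTheory.Measure.ae_ne MeasureTheory.volume π] with θ hne hθ
    rw [Set.uIoc_of_le Real.pi_pos.le] at hθ
    rw [Real.norm_eq_abs, abs_mul]
    exact (mul_le_of_le_one_right (abs_nonneg _) (hg1 θ)).trans
      ((hL1 _).trans (hr θ ⟨hθ.1, lt_of_le_of_ne hθ.2 hne⟩))
  · filter_upwards [MeasureTheory.Measure.ae_ne MeasureTheory.volume π] with θ hne hθ
    rw [Set.uIoc_of_le Real.pi_pos.le] at hθ
    have hθ' : θ ∈ Set.Ioo 0 π := ⟨hθ.1, lt_of_le_of_ne hθ.2 hne⟩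
    refine Filter.Tendsto.mul_const _ ((hL.tendsto _).comp ?_)
    have h1 : ContinuousAt (fun r : ℝ => fmFun v m (r * Complex.exp (θ * Complex.I))) 1 :=
      ContinuousAt.comp (f := fun r : ℝ => (r : ℂ) * Complex.exp (θ * Complex.I))
        (hv.continuousAt_fmFun m (mul_exp_mem_slitDom one_pos hθ')) (by fun_prop)
    simpa [ContinuousAt] using h1.tendsto.mono_left nhdsWithin_le_nhds

lemma tendsto_mul_pow_nhdsLT_one (x : ℝ) (n : ℕ) :
    Filter.Tendsto (fun r : ℝ => π / 2 * (x * r ^ n)) (nhdsWithin 1 (Set.Iio 1))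
      (nhds (π / 2 * x)) := by
  have h : Continuous fun r : ℝ => π / 2 * (x * r ^ n) := by fun_prop
  simpa using (h.tendsto 1).mono_left nhdsWithin_le_nhds

lemma IsCoeff.integral_re_mul_cos (ha : IsCoeff κ v a) (hv : IsVmap κ v)
    (hκ : κ ∈ Set.Ioo (0 : ℝ) 1) (hK : 0 < Kell κ) {m n : ℕ} (hm : 1 ≤ m) (hn : 1 ≤ n) :
    ∫ θ in (0 : ℝ)..π, (fmFun v m (Complex.exp (θ * Complex.I))).re * Real.cos (n * θ) =
      π / 2 * a n m := by
  refine tendsto_nhds_unique ((hv.tendsto_integral hκ hK m Complex.continuous_re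
    Complex.abs_re_le_norm (g := fun θ => Real.cos (n * θ)) (by fun_prop)
    fun θ => Real.abs_cos_le_one _).congr' ?_) (tendsto_mul_pow_nhdsLT_one _ n)
  filter_upwards [Ioo_mem_nhdsLT one_pos] with r hr
  exact integral_mul_cos_of_hasSum (ha.summable_abs hκ.1 hm hr.1 hr.2)
    (fun θ hθ => ha.hasSum_re hm hr.1 hr.2 hθ) hn

lemma IsCoeff.integral_im_mul_sin (ha : IsCoeff κ v a) (hv : IsVmap κ v)
    (hκ : κ ∈ Set.Ioo (0 : ℝ) 1) (hK : 0 < Kell κ) {m n : ℕ} (hm : 1 ≤ m) (hn : 1 ≤ n) :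
    ∫ θ in (0 : ℝ)..π, (fmFun v m (Complex.exp (θ * Complex.I))).im * Real.sin (n * θ) =
      π / 2 * a n m := by
  refine tendsto_nhds_unique ((hv.tendsto_integral hκ hK m Complex.continuous_im
    Complex.abs_im_le_norm (g := fun θ => Real.sin (n * θ)) (by fun_prop)
    fun θ => Real.abs_sin_le_one _).congr' ?_) (tendsto_mul_pow_nhdsLT_one _ n)
  filter_upwards [Ioo_mem_nhdsLT one_pos] with r hr
  exact integral_mul_sin_of_hasSum (ha.summable_abs hκ.1 hm hr.1 hr.2)
    (fun θ hθ => ha.hasSum_im hm hr.1 hr.2 hθ) hn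

end Coeff

/-! ### Parseval's identity for sine series -/

lemma integral_neg_pi_pi {E : Type*} [NormedAddCommGroup E] [NormedSpace ℝ E] {h : ℝ → E}
    (hh : Continuous h) :
    ∫ θ in (-π)..(-π + 2 * π), h θ = ∫ θ in (0 : ℝ)..π, (h θ + h (-θ)) := by
  rw [intervalIntegral.integral_add (hh.intervalIntegrable _ _)
    (Continuous.intervalIntegrable (by fun_prop) _ _), intervalIntegral.integral_comp_neg, neg_zero,
    add_comm (∫ θ in (0 : ℝ)..π, h θ), intervalIntegral.integral_add_adjacent_intervals (hh.intervalIntegrable _ _)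
      (hh.intervalIntegrable _ _)]
  congr 1
  ring

/-- The complex continuous function on the circle of length `2π` induced by a continuous real
`2π`-periodic function. -/
def circleLift (f : ℝ → ℝ) (hf : Continuous f) (hper : Function.Periodic f (2 * π)) :
    C(AddCircle (2 * π), ℂ) where
  toFun x := (hper.lift x : ℂ)
  continuous_toFun := Complex.continuous_ofReal.comp
    (hf.quotient_lift (s := QuotientAddGroup.leftRel (AddSubgroup.zmultiples (2 * π))) _)

lemma circleLift_coe (f : ℝ → ℝ) (hf : Continuous f) (hper : Function.Periodic f (2 * π)) (x : ℝ) :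
    circleLift f hf hper (x : AddCircle (2 * π)) = f x := rfl

lemma fourierCoeff_circleLift [Fact (0 < 2 * π)] {f : ℝ → ℝ} (hf : Continuous f)
    (hper : Function.Periodic f (2 * π)) (hodd : ∀ x, f (-x) = -f x) (n : ℤ) :
    fourierCoeff (circleLift f hf hper) n =
      -(Complex.I / π) * ((∫ θ in (0 : ℝ)..π, f θ * Real.sin (n * θ) : ℝ) : ℂ) := by
  have hpi : (π : ℂ) ≠ 0 := by exact_mod_cast Real.pi_ne_zero
  have hfour : ∀ x : ℝ, fourier (-n) (x : AddCircle (2 * π)) =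
      Complex.exp ((-(n * x) : ℝ) * Complex.I) := by
    intro x
    rw [fourier_coe_apply]
    congr 1
    push_cast
    field_simp
  rw [fourierCoeff_eq_intervalIntegral _ _ (-π)]
  simp_rw [circleLift_coe, hfour, smul_eq_mul]
  rw [integral_neg_pi_pi (h := fun x : ℝ => Complex.exp ((-(n * x) : ℝ) * Complex.I) * (f x : ℂ))
    (by fun_prop)]
  have hint : ∀ x : ℝ, Complex.exp ((-(n * x) : ℝ) * Complex.I) * (f x : ℂ) +
      Complex.exp ((-(n * -x) : ℝ) * Complex.I) * (f (-x) : ℂ) =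
      (-2 * Complex.I) * ((f x * Real.sin (n * x) : ℝ) : ℂ) := by
    intro x
    rw [hodd, Complex.exp_mul_I, Complex.exp_mul_I]
    push_cast
    rw [show (n : ℂ) * -x = -(n * x) by ring, neg_neg, Complex.cos_neg, Complex.sin_neg]
    ring
  simp_rw [hint]
  rw [intervalIntegral.integral_const_mul, intervalIntegral.integral_ofReal, Complex.real_smul]
  push_cast
  field_simp

theorem hasSum_integral_sin_mul {f g : ℝ → ℝ} (hf : Continuous f) (hg : Continuous g)
    (hfper : Function.Periodic f (2 * π)) (hgper : Function.Periodic g (2 * π))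
    (hfodd : ∀ x, f (-x) = -f x) (hgodd : ∀ x, g (-x) = -g x) :
    HasSum (fun n : ℕ => (∫ θ in (0 : ℝ)..π, f θ * Real.sin ((n + 1 : ℕ) * θ)) *
        ∫ θ in (0 : ℝ)..π, g θ * Real.sin ((n + 1 : ℕ) * θ))
      (π / 2 * ∫ θ in (0 : ℝ)..π, f θ * g θ) := by
  have : Fact (0 < 2 * π) := ⟨Real.two_pi_pos⟩
  have hpi : (π : ℂ) ≠ 0 := by exact_mod_cast Real.pi_ne_zero
  set U := circleLift f hf hfper with hU
  set V := circleLift g hg hgper with hV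
  set F : ℤ → ℝ := fun n => ∫ θ in (0 : ℝ)..π, f θ * Real.sin (n * θ) with hF
  set G : ℤ → ℝ := fun n => ∫ θ in (0 : ℝ)..π, g θ * Real.sin (n * θ) with hG
  have h := (fourierBasis (T := 2 * π)).hasSum_inner_mul_inner
    (ContinuousMap.toLp (E := ℂ) 2 AddCircle.haarAddCircle ℂ U)
    (ContinuousMap.toLp (E := ℂ) 2 AddCircle.haarAddCircle ℂ V)
  rw [MeasureTheory.ContinuousMap.inner_toLp, AddCircle.integral_haarAddCircle,
    ← AddCircle.intervalIntegral_preimage (2 * π) (-π)] at h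
  have hval : (2 * π)⁻¹ • ∫ x in (-π)..(-π + 2 * π), V (x : AddCircle (2 * π)) *
      (starRingEnd ℂ) (U (x : AddCircle (2 * π))) =
      ((π⁻¹ * ∫ θ in (0 : ℝ)..π, f θ * g θ : ℝ) : ℂ) := by
    simp_rw [hU, hV, circleLift_coe, Complex.conj_ofReal, ← Complex.ofReal_mul]
    rw [intervalIntegral.integral_ofReal, integral_neg_pi_pi (by fun_prop)]
    simp_rw [hfodd, hgodd, neg_mul_neg, ← two_mul]
    rw [intervalIntegral.integral_const_mul, Complex.real_smul, ← Complex.ofReal_mul]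
    congr 1
    simp_rw [mul_comm (g _)]
    field_simp
  rw [hval] at h
  have hterm : ∀ n : ℤ, inner ℂ (ContinuousMap.toLp (E := ℂ) 2 AddCircle.haarAddCircle ℂ U)
      ((fourierBasis (T := 2 * π)) n) * inner ℂ ((fourierBasis (T := 2 * π)) n)
      (ContinuousMap.toLp (E := ℂ) 2 AddCircle.haarAddCircle ℂ V) =
      (((π ^ 2)⁻¹ * (F n * G n) : ℝ) : ℂ) := by
    intro n
    rw [← inner_conj_symm, ← HilbertBasis.repr_apply_apply, ← HilbertBasis.repr_apply_apply,
      fourierBasis_repr, fourierBasis_repr, fourierCoeff_toLp, fourierCoeff_toLp,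
      fourierCoeff_circleLift hf hfper hfodd, fourierCoeff_circleLift hg hgper hgodd, map_mul,
      map_neg, map_div₀, Complex.conj_I, Complex.conj_ofReal, Complex.conj_ofReal]
    simp only [hF, hG]
    push_cast
    field_simp
    ring_nf
    simp
  simp_rw [hterm] at h
  have h2 := (Complex.hasSum_ofReal.1 h).nat_add_neg
  have hF0 : F 0 = 0 := by simp [hF]
  have hFneg : ∀ n : ℤ, F (-n) = -F n := fun n => by
    simp [hF, neg_mul, Real.sin_neg]
  have hGneg : ∀ n : ℤ, G (-n) = -G n := fun n => by
    simp [hG, neg_mul, Real.sin_neg]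
  simp_rw [hFneg, hGneg, hF0, neg_mul_neg] at h2
  rw [← hasSum_nat_add_iff' 1] at h2
  have hFnat : ∀ n : ℕ, F (n : ℤ) = ∫ θ in (0 : ℝ)..π, f θ * Real.sin (n * θ) := fun n => by
    simp [hF]
  have hGnat : ∀ n : ℕ, G (n : ℤ) = ∫ θ in (0 : ℝ)..π, g θ * Real.sin (n * θ) := fun n => by
    simp [hG]
  simp_rw [← hFnat, ← hGnat]
  have hsum : π / 2 * ∫ θ in (0 : ℝ)..π, f θ * g θ = π ^ 2 / 2 *
      ((π⁻¹ * ∫ θ in (0 : ℝ)..π, f θ * g θ) + (π ^ 2)⁻¹ * (0 * G 0) -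
        ∑ i ∈ Finset.range 1,
          ((π ^ 2)⁻¹ * (F i * G i) + (π ^ 2)⁻¹ * (F i * G i))) := by
    rw [Finset.sum_range_one, Nat.cast_zero, hF0]
    field_simp
    ring
  rw [hsum]
  refine (h2.mul_left (π ^ 2 / 2)).congr_fun fun n => ?_
  field_simp
  ring

/-! ### The coefficients `a_{n,m}` -/

section Eigen

variable {k : ℝ} {v : ℂ → ℂ} {a : ℕ → ℕ → ℝ}

lemma complex_cos_nat_mul_pi_sub (m : ℕ) (z : ℂ) :
    Complex.cos (m * π - z) = (-1) ^ m * Complex.cos z := by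
  rw [← Complex.cos_neg, neg_sub, Complex.cos_antiperiodic.sub_nat_mul_eq]

lemma cos_nat_mul_pi_sub_add_mul_I (m : ℕ) (x y : ℝ) :
    Complex.cos (m * π - x + y * Complex.I) =
      (((-1) ^ m * (Real.cos x * Real.cosh y) : ℝ) : ℂ) +
        (((-1) ^ m * (Real.sin x * Real.sinh y) : ℝ) : ℂ) * Complex.I := by
  rw [show (m * π - x + y * Complex.I : ℂ) = m * π - (x + (-y : ℂ) * Complex.I) by ring,
    complex_cos_nat_mul_pi_sub, Complex.cos_add_mul_I]
  push_cast
  rw [Complex.cosh_neg, Complex.sinh_neg]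
  ring

lemma fmFun_exp (hk : k ∈ Set.Ioo (0 : ℝ) 1) (hv : IsVmap (kLanden k) v) (m : ℕ) {θ : ℝ}
    (hθ : θ ∈ Set.Ioo 0 π) :
    fmFun v m (Complex.exp (θ * Complex.I)) =
      (((-1) ^ m * (Real.cos (2 * π * m * ellAngle k θ) * Real.cosh (2 * π * m * Tell k)) -
          Real.cos (π * m / 2) : ℝ) : ℂ) +
        (((-1) ^ m * (Real.sin (2 * π * m * ellAngle k θ) * Real.sinh (2 * π * m * Tell k)) : ℝ) :
          ℂ) * Complex.I := by
  rw [fmFun, hv.apply_exp hk hθ]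
  rw [show 2 * (π : ℂ) * m * (1 / 4 - ellAngle k θ + Tell k * Complex.I + 1 / 4) =
    m * π - (2 * π * m * ellAngle k θ : ℝ) + (2 * π * m * Tell k : ℝ) * Complex.I by
      push_cast; ring, cos_nat_mul_pi_sub_add_mul_I]
  push_cast
  ring

lemma fmFun_smallRoot (hk : k ∈ Set.Ioo (0 : ℝ) 1) (hv : IsVmap (kLanden k) v) (m : ℕ) {θ : ℝ}
    (hθ : θ ∈ Set.Ioo 0 π) :
    fmFun v m (smallRoot k θ) =
      (((-1) ^ m * Real.cos (2 * π * m * ellAngle k θ) - Real.cos (π * m / 2) : ℝ) : ℂ) := by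
  rw [fmFun, hv.apply_smallRoot hk hθ]
  rw [show 2 * (π : ℂ) * m * (1 / 4 - ellAngle k θ + 1 / 4) =
    m * π - (2 * π * m * ellAngle k θ : ℝ) by push_cast; ring, complex_cos_nat_mul_pi_sub]
  push_cast
  ring

lemma integral_cos_nat_mul {n : ℕ} (hn : 1 ≤ n) :
    ∫ θ in (0 : ℝ)..π, Real.cos (n * θ) = 0 := by
  have h := integral_cos_int_mul n
  rwa [if_neg (by omega), Int.cast_natCast] at h

lemma integral_congr_Ioo {f g : ℝ → ℝ} (h : ∀ θ ∈ Set.Ioo 0 π, f θ = g θ) :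
    ∫ θ in (0 : ℝ)..π, f θ = ∫ θ in (0 : ℝ)..π, g θ := by
  refine intervalIntegral.integral_congr_ae ?_
  filter_upwards [MeasureTheory.Measure.ae_ne MeasureTheory.volume π] with θ hne hθ
  rw [Set.uIoc_of_le Real.pi_pos.le] at hθ
  exact h θ ⟨hθ.1, lt_of_le_of_ne hθ.2 hne⟩

lemma integral_cos_ellAngle_sub_mul_cos (hk : k ∈ Set.Ioo (0 : ℝ) 1) (m : ℕ) (x c : ℝ) {n : ℕ}
    (hn : 1 ≤ n) :
    ∫ θ in (0 : ℝ)..π, (x * Real.cos (2 * π * m * ellAngle k θ) - c) * Real.cos (n * θ) =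
      x * ∫ θ in (0 : ℝ)..π, Real.cos (2 * π * m * ellAngle k θ) * Real.cos (n * θ) := by
  have hZ := continuous_ellAngle hk
  simp_rw [sub_mul, mul_assoc x]
  rw [intervalIntegral.integral_sub (Continuous.intervalIntegrable (by fun_prop) _ _)
    (Continuous.intervalIntegrable (by fun_prop) _ _), intervalIntegral.integral_const_mul,
    intervalIntegral.integral_const_mul, integral_cos_nat_mul hn]
  ring

lemma IsCoeff.cos_eq (hk : k ∈ Set.Ioo (0 : ℝ) 1) (hv : IsVmap (kLanden k) v)
    (ha : IsCoeff (kLanden k) v a) {m n : ℕ} (hm : 1 ≤ m) (hn : 1 ≤ n) :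
    (-1) ^ m * Real.cosh (2 * π * m * Tell k) *
      ∫ θ in (0 : ℝ)..π, Real.cos (2 * π * m * ellAngle k θ) * Real.cos (n * θ) =
      π / 2 * a n m := by
  rw [← ha.integral_re_mul_cos hv (kLanden_mem hk) (kell_pos (kLanden_mem hk)) hm hn,
    ← integral_cos_ellAngle_sub_mul_cos hk m _ (Real.cos (π * m / 2)) hn]
  refine integral_congr_Ioo fun θ hθ => ?_
  rw [fmFun_exp hk hv m hθ, Complex.add_re, Complex.ofReal_re, Complex.re_ofReal_mul, Complex.I_re]
  ring

lemma IsCoeff.sin_eq (hk : k ∈ Set.Ioo (0 : ℝ) 1) (hv : IsVmap (kLanden k) v)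
    (ha : IsCoeff (kLanden k) v a) {m n : ℕ} (hm : 1 ≤ m) (hn : 1 ≤ n) :
    (-1) ^ m * Real.sinh (2 * π * m * Tell k) *
      ∫ θ in (0 : ℝ)..π, Real.sin (2 * π * m * ellAngle k θ) * Real.sin (n * θ) =
      π / 2 * a n m := by
  rw [← ha.integral_im_mul_sin hv (kLanden_mem hk) (kell_pos (kLanden_mem hk)) hm hn,
    ← intervalIntegral.integral_const_mul]
  refine integral_congr_Ioo fun θ hθ => ?_
  rw [fmFun_exp hk hv m hθ, Complex.add_im, Complex.ofReal_im, Complex.im_ofReal_mul, Complex.I_im]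
  ring

/-- The derivative of `ellAngle k`. -/
def ellAngleDeriv (k θ : ℝ) : ℝ := (4 * Kell k)⁻¹ * (ellRoot k θ)⁻¹

lemma continuous_ellAngleDeriv (hk : k ∈ Set.Ioo (0 : ℝ) 1) : Continuous (ellAngleDeriv k) :=
  (continuous_inv_ellRoot hk).const_mul _

lemma integral_cos_ellAngle_mul_cos (hk : k ∈ Set.Ioo (0 : ℝ) 1) (m n : ℕ) :
    n * ∫ θ in (0 : ℝ)..π, Real.cos (2 * π * m * ellAngle k θ) * Real.cos (n * θ) =
      2 * π * m * ∫ θ in (0 : ℝ)..π,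
        ellAngleDeriv k θ * Real.sin (2 * π * m * ellAngle k θ) * Real.sin (n * θ) := by
  have hZ := continuous_ellAngle hk
  have hZ' := continuous_ellAngleDeriv hk
  have h := intervalIntegral.integral_mul_deriv_eq_deriv_mul (a := 0) (b := π)
    (u := fun θ => Real.cos (2 * π * m * ellAngle k θ))
    (u' := fun θ => -Real.sin (2 * π * m * ellAngle k θ) * (2 * π * m * ellAngleDeriv k θ))
    (v := fun θ => Real.sin (n * θ)) (v' := fun θ => Real.cos (n * θ) * n)
    (fun θ _ => ((hasDerivAt_ellAngle hk θ).const_mul _).cos)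
    (fun θ _ => by simpa using ((hasDerivAt_id θ).const_mul (n : ℝ)).sin)
    (Continuous.intervalIntegrable (by fun_prop) _ _)
    (Continuous.intervalIntegrable (by fun_prop) _ _)
  rw [Real.sin_nat_mul_pi, mul_zero, mul_zero, Real.sin_zero, mul_zero, sub_self, zero_sub,
    ← intervalIntegral.integral_neg] at h
  rw [← intervalIntegral.integral_const_mul, ← intervalIntegral.integral_const_mul]
  convert h using 1
  · refine intervalIntegral.integral_congr fun θ _ => ?_
    ring
  · refine intervalIntegral.integral_congr fun θ _ => ?_
    ring

lemma integral_ellAngleDeriv_mul_sin_mul_sin (hk : k ∈ Set.Ioo (0 : ℝ) 1) (m : ℕ) {m' : ℕ}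
    (hm' : 1 ≤ m') :
    ∫ θ in (0 : ℝ)..π, ellAngleDeriv k θ * Real.sin (2 * π * m * ellAngle k θ) *
      Real.sin (2 * π * m' * ellAngle k θ) = if m = m' then 1 / 4 else 0 := by
  have h1 := intervalIntegral.integral_comp_mul_deriv (a := 0) (b := π)
    (f := fun θ => 2 * π * ellAngle k θ) (f' := fun θ => 2 * π * ellAngleDeriv k θ)
    (g := fun x => Real.sin (m * x) * Real.sin (m' * x))
    (fun θ _ => (hasDerivAt_ellAngle hk θ).const_mul _)
    ((continuous_ellAngleDeriv hk).const_mul _).continuousOn (by fun_prop)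
  rw [ellAngle_zero, ellAngle_pi hk, mul_zero, show 2 * π * (1 / 2) = π by ring,
    integral_sin_mul_sin m hm'] at h1
  have h2 : ∀ θ, ellAngleDeriv k θ * Real.sin (2 * π * m * ellAngle k θ) *
      Real.sin (2 * π * m' * ellAngle k θ) = (2 * π)⁻¹ * (((fun x => Real.sin (m * x) *
        Real.sin (m' * x)) ∘ fun θ => 2 * π * ellAngle k θ) θ * (2 * π * ellAngleDeriv k θ)) := by
    intro θ
    have e : ∀ j : ℕ, 2 * π * j * ellAngle k θ = j * (2 * π * ellAngle k θ) := fun j => by ring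
    simp only [Function.comp, e]
    field_simp
  simp_rw [h2]
  rw [intervalIntegral.integral_const_mul, h1]
  split_ifs
  · field_simp
    norm_num
  · simp

lemma ellAngle_add_two_pi (hk : k ∈ Set.Ioo (0 : ℝ) 1) (θ : ℝ) :
    ellAngle k (θ + 2 * π) = ellAngle k θ + 1 := by
  rw [show θ + 2 * π = θ + π + π by ring, ellAngle_add_pi hk, ellAngle_add_pi hk]
  ring

lemma sin_ellAngle_periodic (hk : k ∈ Set.Ioo (0 : ℝ) 1) (m : ℕ) :
    Function.Periodic (fun θ => Real.sin (2 * π * m * ellAngle k θ)) (2 * π) := by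
  intro θ
  simp only
  rw [ellAngle_add_two_pi hk, show 2 * π * m * (ellAngle k θ + 1) =
    2 * π * m * ellAngle k θ + m * (2 * π) by ring, Real.sin_add_nat_mul_two_pi]

lemma ellAngleDeriv_periodic (k : ℝ) : Function.Periodic (ellAngleDeriv k) (2 * π) := by
  intro θ
  rw [ellAngleDeriv, show θ + 2 * π = θ + π + π by ring, ellRoot_add_pi, ellRoot_add_pi,
    ellAngleDeriv]

lemma IsCoeff.hasSum_mul (hk : k ∈ Set.Ioo (0 : ℝ) 1) (hv : IsVmap (kLanden k) v)
    (ha : IsCoeff (kLanden k) v a) {m m' : ℕ} (hm : 1 ≤ m) (hm' : 1 ≤ m') :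
    HasSum (fun n : ℕ => ((n : ℝ) + 1) * a (n + 1) m * a (n + 1) m')
      (if m = m' then
        m * (Real.cosh (2 * π * m * Tell k) * Real.sinh (2 * π * m * Tell k)) else 0) := by
  have hZ := continuous_ellAngle hk
  have hZ' := continuous_ellAngleDeriv hk
  have h := hasSum_integral_sin_mul
    (f := fun θ => ellAngleDeriv k θ * Real.sin (2 * π * m * ellAngle k θ))
    (g := fun θ => Real.sin (2 * π * m' * ellAngle k θ)) (by fun_prop) (by fun_prop)
    ((ellAngleDeriv_periodic k).mul (sin_ellAngle_periodic hk m)) (sin_ellAngle_periodic hk m')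
    (fun x => by simp [ellAngleDeriv, ellRoot_neg, ellAngle_neg])
    (fun x => by simp [ellAngle_neg])
  rw [integral_ellAngleDeriv_mul_sin_mul_sin hk m hm'] at h
  have h2 := h.mul_left ((2 / π) ^ 2 * (2 * π * m) * ((-1) ^ m * Real.cosh (2 * π * m * Tell k)) *
    ((-1) ^ m' * Real.sinh (2 * π * m' * Tell k)))
  have hval : (if m = m' then
        m * (Real.cosh (2 * π * m * Tell k) * Real.sinh (2 * π * m * Tell k)) else 0) =
      (2 / π) ^ 2 * (2 * π * m) * ((-1) ^ m * Real.cosh (2 * π * m * Tell k)) *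
        ((-1) ^ m' * Real.sinh (2 * π * m' * Tell k)) * (π / 2 * if m = m' then 1 / 4 else 0) := by
    split_ifs with hmm
    · subst hmm
      have h1 : ((-1 : ℝ) ^ m) * (-1) ^ m = 1 := by rw [← mul_pow]; simp
      have h2 : (2 / π) ^ 2 * π ^ 2 = 4 := by
        field_simp
        norm_num
      linear_combination (-(m * Real.cosh (2 * π * m * Tell k) *
        Real.sinh (2 * π * m * Tell k))) * h1 - (m * Real.cosh (2 * π * m * Tell k) *
        Real.sinh (2 * π * m * Tell k) * ((-1) ^ m * (-1) ^ m) / 4) * h2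
    · simp
  rw [hval]
  refine h2.congr_fun fun n => ?_
  have hc := ha.cos_eq hk hv hm (n := n + 1) (by omega)
  have hs := ha.sin_eq hk hv hm' (n := n + 1) (by omega)
  have hparts := integral_cos_ellAngle_mul_cos hk m (n + 1)
  have e1 : a (n + 1) m = 2 / π * (π / 2 * a (n + 1) m) := by field_simp
  have e2 : a (n + 1) m' = 2 / π * (π / 2 * a (n + 1) m') := by field_simp
  rw [e1, e2, ← hc, ← hs]
  push_cast at hparts ⊢
  linear_combination ((2 / π) ^ 2 * ((-1) ^ m * Real.cosh (2 * π * m * Tell k)) *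
    ((-1) ^ m' * Real.sinh (2 * π * m' * Tell k)) * (∫ θ in (0 : ℝ)..π,
      Real.sin (2 * π * m' * ellAngle k θ) * Real.sin ((n + 1) * θ))) * hparts

lemma IsCoeff.hasSum_wgen_mul (hk : k ∈ Set.Ioo (0 : ℝ) 1) (hv : IsVmap (kLanden k) v)
    (ha : IsCoeff (kLanden k) v a) {l m : ℕ} (hl : 1 ≤ l) (hm : 1 ≤ m) :
    HasSum (fun p : ℕ => Wgen (k / 4) l (p + 1) (π / 2) (Set.Ioo (-(π / 2)) (π / 2)) *
      a (p + 1) m) (a l m / (2 * Real.cosh (2 * π * m * Tell k))) := by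
  have hκ := kLanden_mem hk
  have hr0 : 0 < Real.sqrt (kLanden k) := Real.sqrt_pos.2 hκ.1
  have hr1 : Real.sqrt (kLanden k) < 1 := by
    rw [Real.sqrt_lt' one_pos]; simpa using hκ.2
  have hsmall : ∀ θ ∈ Set.Ioo 0 π, smallRoot k θ ^ 2 < kLanden k := fun θ hθ =>
    smallRoot_sq_lt hk (Real.sin_pos_of_pos_of_lt_pi hθ.1 hθ.2)
  have hs := continuous_smallRoot hk
  have h := hasSum_integral_zero_pi
    (F := fun p θ => a p m * smallRoot k θ ^ p * Real.cos (l * θ))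
    (f := fun θ => ((-1) ^ m * Real.cos (2 * π * m * ellAngle k θ) - Real.cos (π * m / 2)) *
      Real.cos (l * θ)) (fun j => by fun_prop) (ha.summable_abs hκ.1 hm hr0 hr1)
    (fun j θ hθ => ?_) (fun θ hθ => HasSum.mul_right _ ?_)
  · rw [integral_cos_ellAngle_sub_mul_cos hk m _ _ hl, ← hasSum_nat_add_iff' 1,
      Finset.sum_range_one, ha.zero_eq_zero hv hκ.1 hm] at h
    simp only [zero_mul, intervalIntegral.integral_zero, sub_zero] at h
    have hc := ha.cos_eq hk hv hm hl
    have hcosh := Real.cosh_pos (2 * π * m * Tell k)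
    have hval : a l m / (2 * Real.cosh (2 * π * m * Tell k)) = π⁻¹ * ((-1) ^ m *
        ∫ θ in (0 : ℝ)..π, Real.cos (2 * π * m * ellAngle k θ) * Real.cos (l * θ)) := by
      field_simp
      linear_combination (-2 : ℝ) * hc
    rw [hval]
    refine (h.mul_left π⁻¹).congr_fun fun p => ?_
    simp_rw [wgen_eq_integral hk hl, mul_assoc, intervalIntegral.integral_const_mul]
    ring
  · rw [abs_mul]
    refine (mul_le_of_le_one_right (abs_nonneg _) (Real.abs_cos_le_one _)).trans ?_
    rw [abs_mul, abs_mul, abs_pow, abs_pow, abs_of_pos hr0]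
    gcongr
    exact Real.abs_le_sqrt (hsmall θ hθ).le
  · have h1 := ha m hm (smallRoot k θ) (ofReal_mem_slitDom (hsmall θ hθ)) (by
      rw [Complex.norm_real, Real.norm_eq_abs, ← sq_lt_one_iff_abs_lt_one]
      exact (hsmall θ hθ).trans hκ.2)
    rw [fmFun_smallRoot hk hv m hθ] at h1
    exact_mod_cast h1

lemma qNome_rpow (hk : k ∈ Set.Ioo (0 : ℝ) 1) (x : ℝ) :
    qNome k ^ x = Real.exp (-(4 * π * x * Tell k)) := by
  have hK := kell_pos hk
  rw [qNome, ← Real.exp_mul, Tell]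
  congr 1
  field_simp

end Eigen

/-- Proposition 5 (diagonalization of `J_k`): (a) the orthogonality relations
`Σ_n n a_{n,m} a_{n,m'} = (m(q^{-m}-q^m)/4) δ_{m,m'}`; (b) `(f_m)` are eigenvectors of the
operator with matrix elements `J_{l,p}(t) = W^{(π/2,(-π/2,π/2))}_{l,p}(t)`, with eigenvalue
`1/(q^{m/2}+q^{-m/2})`. Both sums converge absolutely. -/
theorem statement4 (k : ℝ) (hk : k ∈ Set.Ioo (0 : ℝ) 1) (t : ℝ) (ht : t = k / 4)
    (v : ℂ → ℂ) (hv : IsVmap (kLanden k) v)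
    (a : ℕ → ℕ → ℝ) (ha : IsCoeff (kLanden k) v a) :
    (∀ m m' : ℕ, 1 ≤ m → 1 ≤ m' →
      Summable (fun n : ℕ => ((n : ℝ) + 1) * a (n + 1) m * a (n + 1) m') ∧
      (∑' n : ℕ, ((n : ℝ) + 1) * a (n + 1) m * a (n + 1) m') =
        if m = m' then (m : ℝ) * (qNome k ^ (-(m : ℝ)) - qNome k ^ (m : ℝ)) / 4 else 0) ∧
    (∀ l m : ℕ, 1 ≤ l → 1 ≤ m →
      Summable (fun p : ℕ =>
        Wgen t l (p + 1) (π / 2) (Set.Ioo (-(π / 2)) (π / 2)) * a (p + 1) m) ∧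
      (∑' p : ℕ, Wgen t l (p + 1) (π / 2) (Set.Ioo (-(π / 2)) (π / 2)) * a (p + 1) m) =
        a l m / (qNome k ^ ((m : ℝ) / 2) + qNome k ^ (-(m : ℝ) / 2))) := by
  have hq : ∀ x : ℝ, qNome k ^ x = Real.exp (-(4 * π * x * Tell k)) := qNome_rpow hk
  subst ht
  refine ⟨fun m m' hm hm' => ?_, fun l m hl hm => ?_⟩
  · have h := ha.hasSum_mul hk hv hm hm'
    refine ⟨h.summable, h.tsum_eq.trans ?_⟩
    congr 1
    rw [hq, hq, Real.cosh_eq, Real.sinh_eq,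
      show -(4 * π * -(m : ℝ) * Tell k) = 2 * π * m * Tell k + 2 * π * m * Tell k by ring,
      show -(4 * π * (m : ℝ) * Tell k) = -(2 * π * m * Tell k) + -(2 * π * m * Tell k) by ring,
      Real.exp_add, Real.exp_add]
    ring
  · have h := ha.hasSum_wgen_mul hk hv hl hm
    refine ⟨h.summable, h.tsum_eq.trans ?_⟩
    congr 1
    rw [hq, hq, Real.cosh_eq,
      show -(4 * π * (-(m : ℝ) / 2) * Tell k) = 2 * π * m * Tell k by ring,
      show -(4 * π * ((m : ℝ) / 2) * Tell k) = -(2 * π * m * Tell k) by ring]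
    ring

end
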